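/- arXiv:1810.00990 — 7 statements merged into one kernel-verified Lean document; each statement's English description precedes it below -/
import Mathlib

section
/- Let p be a prime number, r ≥ 1, q = p^r. Let K be a function field of one variable over the algebraic closure Qbar of ℚ, let t ∈ K be non-constant, and let f = X^q + C t ∈ K[X]. Then for any β ∈ K that is not periodic for f, the pair (f, β) is eventually stable over K: there exists a constant C such that for every n ≥ 1, the number of irreducible factors of f^n(X) − β in K[X], counted with multiplicity, is at most C. -/
open Polynomial

/-- The `n`-th iterate of a polynomial under composition (`polyIter f 0 = X`). -/
noncomputable def polyIter {K : Type*} [CommRing K] (f : K[X]) : ℕ → K[X]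
  | 0 => X
  | n + 1 => f.comp (polyIter f n)


lemma es_exists_transc (p : ℕ) [Fact p.Prime] : ∃ u : ℚ_[p], Transcendental ℚ u ∧ ‖u‖ < 1 := by
  have h1 : ¬ Set.Countable {x : ℚ_[p] | IsAlgebraic ℚ x} ∨ ∃ u : ℚ_[p], Transcendental ℚ u := by
    right
    by_contra! h
    have hc : Set.Countable {x : ℚ_[p] | IsAlgebraic ℚ x} := Algebraic.countable ℚ ℚ_[p]
    have : {x : ℚ_[p] | IsAlgebraic ℚ x} = Set.univ := by
      ext x; simpa [Transcendental] using h x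
    rw [this] at hc
    have h2 := continuum_le_cardinal_of_nontriviallyNormedField ℚ_[p]
    have h3 := Cardinal.le_aleph0_iff_set_countable.mpr hc
    rw [Cardinal.mk_univ] at h3
    exact absurd (h2.trans h3) (not_le.mpr Cardinal.aleph0_lt_continuum)
  have h2 : ∃ u : ℚ_[p], Transcendental ℚ u := by
    rcases h1 with h | h
    · exact absurd (Algebraic.countable ℚ ℚ_[p]) h
    · exact h
  obtain ⟨u, hu⟩ := h2
  have hp : (p : ℚ_[p]) ≠ 0 := by exact_mod_cast (Fact.out : p.Prime).ne_zero
  have hlim : Filter.Tendsto (fun n : ℕ => ‖(p : ℚ_[p]) ^ n * u‖) Filter.atTop (nhds 0) := by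
    have := tendsto_pow_atTop_nhds_zero_of_norm_lt_one (Padic.norm_p_lt_one (p := p))
    simpa using (this.mul_const u).norm
  obtain ⟨n, hn⟩ := (hlim.eventually (gt_mem_nhds one_pos)).exists
  refine ⟨_, ?_, hn⟩
  intro halg
  apply hu
  have hpn : IsAlgebraic ℚ (((p : ℚ_[p]) ^ n)⁻¹) := by
    have := isAlgebraic_algebraMap (R := ℚ) (A := ℚ_[p]) (((p : ℚ) ^ n)⁻¹)
    simpa using this
  have := hpn.mul halg
  rwa [← mul_assoc, inv_mul_cancel₀ (pow_ne_zero _ hp), one_mul] at this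

lemma es_discrete (p : ℕ) [Fact p.Prime] (x : PadicAlgCl p) (D : ℕ)
    (hD : (minpoly ℚ_[p] x).natDegree ≤ D) (hx : ‖x‖ < 1) : ‖x‖ ^ D ≤ (p : ℝ)⁻¹ := by
  have hintegral : IsIntegral ℚ_[p] x := Algebra.IsIntegral.isIntegral x
  have hpos := minpoly.natDegree_pos hintegral
  have h := spectralNorm.spectralNorm_eq_norm_coeff_zero_rpow ℚ_[p] (PadicAlgCl p) x
  rw [PadicAlgCl.spectralNorm_eq] at h
  have h2 : ‖x‖ ^ (minpoly ℚ_[p] x).natDegree = ‖(minpoly ℚ_[p] x).coeff 0‖ := by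
    rw [h, ← Real.rpow_natCast, ← Real.rpow_mul (norm_nonneg _), one_div, inv_mul_cancel₀, Real.rpow_one]
    exact_mod_cast hpos.ne'
  have h3 : ‖(minpoly ℚ_[p] x).coeff 0‖ < 1 := by
    rw [← h2]; exact pow_lt_one₀ (norm_nonneg _) hx hpos.ne'
  have h4 := (Padic.norm_le_pow_iff_norm_lt_pow_add_one ((minpoly ℚ_[p] x).coeff 0) (-1)).mpr (by simpa using h3)
  calc ‖x‖ ^ D ≤ ‖x‖ ^ (minpoly ℚ_[p] x).natDegree := pow_le_pow_of_le_one (norm_nonneg _) hx.le hD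
    _ ≤ _ := by rw [h2]; simpa using h4

lemma es_finite {A K : Type*} [Field A] [Field K] [Algebra (RatFunc A) K]
    [FunctionField A K] [Algebra A K] [IsScalarTower A (RatFunc A) K] (t : K) (ht : Transcendental A t) :
    FiniteDimensional (IntermediateField.adjoin A {t}) K := by
  have h1 : IsTranscendenceBasis A (fun _ : Unit => algebraMap (RatFunc A) K RatFunc.X) := by
    have h0 := IsTranscendenceBasis.polynomial Unit A
    have : Algebra.IsAlgebraic A[X] (RatFunc A) := IsLocalization.isAlgebraic _ (nonZeroDivisors A[X])
    have h2 := (h0.algebraMap_comp (A := RatFunc A)).algebraMap_comp (A := K)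
    convert h2 using 2
    simp
  have ht' : AlgebraicIndependent A (fun _ : Unit => t) := by
    rw [algebraicIndependent_unique_type_iff]; exact ht
  have h3 : IsTranscendenceBasis A (fun _ : Unit => t) := by
    apply AlgebraicIndependent.isTranscendenceBasis_of_lift_trdeg_le_of_finite ht'
    rw [← h1.lift_cardinalMk_eq_trdeg]
  have h4 := h3.isAlgebraic_field
  rw [Set.range_const] at h4
  have h5 : Algebra.EssFiniteType A[X] (RatFunc A) := Algebra.EssFiniteType.of_isLocalization _ (nonZeroDivisors A[X])
  have h6 : Algebra.EssFiniteType A (RatFunc A) := Algebra.EssFiniteType.comp A A[X] (RatFunc A)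
  have : Algebra.EssFiniteType A K := Algebra.EssFiniteType.comp A (RatFunc A) K
  have : Algebra.EssFiniteType (IntermediateField.adjoin A {t}) K := Algebra.EssFiniteType.of_comp A _ K
  exact Algebra.finite_of_essFiniteType_of_isAlgebraic

lemma es_embed {A K Ω : Type*} [Field A] [Field K] [Field Ω] [Algebra A K] [Algebra A Ω] [IsAlgClosed Ω]
    (t : K) (ht : Transcendental A t) [FiniteDimensional (IntermediateField.adjoin A {t}) K]
    (τ : Ω) (hτ : Transcendental A τ) : ∃ σ : K →ₐ[A] Ω, σ t = τ := by
  let e : IntermediateField.adjoin A {t} →ₐ[A] Ω :=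
    (IntermediateField.val _).comp
      (((RatFunc.algEquivOfTranscendental t ht).symm.trans
      (RatFunc.algEquivOfTranscendental τ hτ)).toAlgHom)
  have he : e (IntermediateField.AdjoinSimple.gen A t) = τ := by
    simp [e]
  let := e.toRingHom.toAlgebra
  have : IsScalarTower A (IntermediateField.adjoin A {t}) Ω := IsScalarTower.of_algebraMap_eq (fun x => (e.commutes x).symm)
  let s : K →ₐ[IntermediateField.adjoin A {t}] Ω := IsAlgClosed.lift
  refine ⟨s.restrictScalars A, ?_⟩
  have := s.commutes (IntermediateField.AdjoinSimple.gen A t)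
  simp only [IntermediateField.AdjoinSimple.algebraMap_gen] at this
  exact this.trans he

open IntermediateField.algebraAdjoinAdjoin in
lemma es_clear {A K : Type*} [Field A] [Field K] [Algebra A K] (t : K)
    [FiniteDimensional (IntermediateField.adjoin A {t}) K] (y : K) :
    ∃ (J : ℕ) (a : ℕ → ℕ → A), (∃ i ∈ Finset.range (Module.finrank (IntermediateField.adjoin A {t}) K + 1),
      ∃ j ∈ Finset.range J, a i j = 1) ∧
      ∑ i ∈ Finset.range (Module.finrank (IntermediateField.adjoin A {t}) K + 1),
        ∑ j ∈ Finset.range J, algebraMap A K (a i j) * (t ^ j * y ^ i) = 0 := by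
  classical
  let F := IntermediateField.adjoin A {t}
  set d := Module.finrank F K
  let R := Algebra.adjoin A {t}
  have : IsFractionRing R F := inferInstanceAs (IsFractionRing (Algebra.adjoin A {t}) (IntermediateField.adjoin A {t}))
  let m := minpoly F y
  have hintegral : IsIntegral F y := Algebra.IsIntegral.isIntegral y
  have hm : m ≠ 0 := minpoly.ne_zero hintegral
  have hmd : m.natDegree ≤ d := minpoly.natDegree_le y
  let g : R[X] := IsLocalization.integerNormalization (nonZeroDivisors R) m
  have hg : g ≠ 0 := by
    rw [Ne, IsFractionRing.integerNormalization_eq_zero_iff]; exact hm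
  have hgd : g.natDegree ≤ d :=
    (natDegree_le_natDegree (degree_mono (IsLocalization.integerNormalization_support (nonZeroDivisors R) m))).trans hmd
  have hgy : aeval y g = 0 := 
    IsLocalization.integerNormalization_aeval_eq_zero (nonZeroDivisors R) m (minpoly.aeval F y)
  have hc : ∀ i, ∃ c : A[X], aeval t c = (g.coeff i : K) := by
    intro i
    have := (g.coeff i).2
    have h2 : (g.coeff i : K) ∈ (aeval (R := A) t).range := by
      rw [← Algebra.adjoin_singleton_eq_range_aeval]; exact this
    exact h2
  choose c hc using hc
  have hsum : ∑ i ∈ Finset.range (d + 1), aeval t (c i) * y ^ i = 0 := by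
    rw [← hgy, aeval_eq_sum_range' (Nat.lt_succ_of_le hgd)]
    refine Finset.sum_congr rfl fun i _ => ?_
    rw [hc, Algebra.smul_def]; rfl
  obtain ⟨i0, hi0⟩ : ∃ i, g.coeff i ≠ 0 := by
    by_contra! h; exact hg (Polynomial.ext (by simpa using h))
  have hi0d : i0 ≤ d := (le_natDegree_of_ne_zero hi0).trans hgd
  have hci0 : c i0 ≠ 0 := by
    intro h; apply hi0; have := hc i0; rw [h] at this
    simpa using this.symm
  obtain ⟨j0, hj0⟩ : ∃ j, (c i0).coeff j ≠ 0 := by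
    by_contra! h; exact hci0 (Polynomial.ext (by simpa using h))
  let J := (Finset.range (d+1)).sup (fun i => (c i).natDegree) + 1
  have hJ : ∀ i ∈ Finset.range (d+1), (c i).natDegree < J := fun i hi =>
    Nat.lt_succ_of_le (Finset.le_sup (f := fun i => (c i).natDegree) hi)
  have hi0r : i0 ∈ Finset.range (d+1) := by simp; omega
  refine ⟨J, fun i j => ((c i0).coeff j0)⁻¹ * (c i).coeff j, ⟨i0, hi0r, j0, ?_, inv_mul_cancel₀ hj0⟩, ?_⟩
  · simp only [Finset.mem_range]
    exact (le_natDegree_of_ne_zero hj0).trans_lt (hJ i0 hi0r)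
  · have : ∑ i ∈ Finset.range (d+1), ∑ j ∈ Finset.range J, algebraMap A K (((c i0).coeff j0)⁻¹ * (c i).coeff j) * (t ^ j * y ^ i)
       = algebraMap A K (((c i0).coeff j0)⁻¹) * ∑ i ∈ Finset.range (d + 1), aeval t (c i) * y ^ i := by
      rw [Finset.mul_sum]
      refine Finset.sum_congr rfl fun i hi => ?_
      rw [aeval_eq_sum_range' (hJ i hi), Finset.sum_mul, Finset.mul_sum]
      refine Finset.sum_congr rfl fun j _ => ?_
      rw [Algebra.smul_def, map_mul]; ring
    rw [this, hsum, mul_zero]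

lemma es_trace {F E ι : Type*} [Field F] [CharZero F] [Field E] [CharZero E] [Algebra F E] (s : Finset ι)
    (α : ι → E) (v : ι → F) (hα : ∀ i ∈ s, IsIntegral ℚ (α i)) (i0 : ι) (hi0 : i0 ∈ s) (h1 : α i0 = 1)
    [Algebra.IsAlgebraic F E]
    (h : ∑ i ∈ s, α i * algebraMap F E (v i) = 0) :
    ∃ b : ι → F, (∀ i, IsIntegral ℚ (b i)) ∧ b i0 ≠ 0 ∧ ∑ i ∈ s, b i * v i = 0 := by
  classical
  let G : IntermediateField F E := IntermediateField.adjoin F (α '' s)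
  have : FiniteDimensional F G := by
    have : Finite (α '' (s : Set ι)) := (s.finite_toSet.image α).to_subtype
    exact IntermediateField.finiteDimensional_adjoin (fun x _ => Algebra.IsIntegral.isIntegral x)
  have hmem : ∀ i ∈ s, α i ∈ G := fun i hi => IntermediateField.subset_adjoin F _ ⟨i, hi, rfl⟩
  let a : ι → G := fun i => if hi : i ∈ s then ⟨α i, hmem i hi⟩ else 0
  have ha : ∀ i ∈ s, (a i : E) = α i := fun i hi => by simp [a, hi]
  have hintegral : ∀ i, IsIntegral ℚ (a i) := by
    intro i
    by_cases hi : i ∈ s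
    · have := hα i hi
      rw [← ha i hi] at this
      exact (isIntegral_algebraMap_iff (A := G) (B := E) (algebraMap G E).injective).mp this
    · simp only [a, hi]; exact isIntegral_zero
  refine ⟨fun i => Algebra.trace F G (a i), fun i => Algebra.isIntegral_trace (hintegral i), ?_, ?_⟩
  · have : a i0 = algebraMap F G 1 := by
      apply Subtype.ext; rw [ha i0 hi0, h1]; simp
    simp only [this]
    rw [Algebra.trace_algebraMap]
    have := Module.finrank_pos (R := F) (M := G)
    simp [this.ne']
  · have h2 : ∑ i ∈ s, v i • a i = 0 := by
      apply Subtype.ext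
      have : ((∑ i ∈ s, v i • a i : G) : E) = ∑ i ∈ s, α i * algebraMap F E (v i) := by
        push_cast
        refine Finset.sum_congr rfl fun i hi => ?_
        rw [ha i hi, Algebra.smul_def, mul_comm]
      rw [this, h]; rfl
    have := congrArg (Algebra.trace F G) h2
    rw [map_sum, map_zero] at this
    rw [← this]
    refine Finset.sum_congr rfl fun i hi => ?_
    rw [map_smul, smul_eq_mul, mul_comm]

lemma es_degree (p : ℕ) [Fact p.Prime] {A K : Type*} [Field A] [Field K] [Algebra A K]
    [Algebra A (PadicAlgCl p)]
    (hA : ∀ x : PadicAlgCl p, IsIntegral ℚ x ↔ ∃ a, algebraMap A (PadicAlgCl p) a = x)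
    (t : K) [FiniteDimensional (IntermediateField.adjoin A {t}) K]
    (σ ρ : K →ₐ[A] PadicAlgCl p) (L : IntermediateField ℚ_[p] (PadicAlgCl p))
    [FiniteDimensional ℚ_[p] L] (hσt : σ t ∈ L) (hρt : ρ t ∈ L) (htr : Transcendental A (ρ t))
    (y : K) (hy : σ y ∈ L) :
    (minpoly ℚ_[p] (ρ y)).natDegree ≤
      Module.finrank ℚ_[p] L * Module.finrank (IntermediateField.adjoin A {t}) K := by
  classical
  set d := Module.finrank (IntermediateField.adjoin A {t}) K
  obtain ⟨J, a, ⟨i0, hi0, j0, hj0, ha1⟩, hsum⟩ := es_clear (A := A) t y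
  let s : Finset (ℕ × ℕ) := Finset.range (d+1) ×ˢ Finset.range J
  obtain ⟨b, hbint, hb0, hbsum⟩ := es_trace (F := L) (E := PadicAlgCl p) s
    (fun x => algebraMap A (PadicAlgCl p) (a x.1 x.2)) (fun x => ⟨σ t, hσt⟩ ^ x.2 * ⟨σ y, hy⟩ ^ x.1)
    (fun x _ => (hA _).mpr ⟨_, rfl⟩) (i0, j0) (by simp only [s, Finset.mem_product]; exact ⟨hi0, hj0⟩) (by simp [ha1])
    (by
      have := congrArg σ hsum
      rw [map_zero] at this
      rw [← this, Finset.sum_product, map_sum]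
      refine Finset.sum_congr rfl fun i _ => ?_
      rw [map_sum]
      refine Finset.sum_congr rfl fun j _ => ?_
      simp only [map_mul, map_pow, AlgHom.commutes]
      rfl)
  have hb' : ∀ x, ∃ c : A, algebraMap A (PadicAlgCl p) c = b x := fun x =>
    (hA _).mp ((hbint x).map (IsScalarTower.toAlgHom ℚ L (PadicAlgCl p)))
  choose c hc using hb'
  have hK : ∑ i ∈ Finset.range (d+1), ∑ j ∈ Finset.range J, algebraMap A K (c (i,j)) * (t ^ j * y ^ i) = 0 := by
    apply σ.toRingHom.injective
    have := congrArg (algebraMap L (PadicAlgCl p)) hbsum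
    rw [map_zero] at this
    rw [map_zero, ← this, Finset.sum_product, map_sum, map_sum]
    refine Finset.sum_congr rfl fun i _ => ?_
    rw [map_sum, map_sum]
    refine Finset.sum_congr rfl fun j _ => ?_
    simp only [map_mul, map_pow, AlgHom.toRingHom_eq_coe, RingHom.coe_coe, AlgHom.commutes, hc]
    rfl
  let Q : L[X] := ∑ i ∈ Finset.range (d+1), C (∑ j ∈ Finset.range J, b (i,j) * ⟨ρ t, hρt⟩ ^ j) * X ^ i
  have hQd : Q.natDegree ≤ d := by
    apply natDegree_sum_le_of_forall_le
    intro i hi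
    refine (natDegree_C_mul_X_pow_le _ _).trans ?_
    simp at hi; omega
  have hQ0 : Q ≠ 0 := by
    intro h
    have h1 := congrArg (fun P => P.coeff i0) h
    simp only [Q, finsetSum_coeff, coeff_C_mul_X_pow, coeff_zero, Finset.sum_ite_eq] at h1
    rw [if_pos hi0] at h1
    have h2 := congrArg (algebraMap L (PadicAlgCl p)) h1
    rw [map_sum, map_zero] at h2
    have h3 : aeval (ρ t) (∑ j ∈ Finset.range J, C (c (i0, j)) * X ^ j) = 0 := by
      rw [← h2, map_sum]
      refine Finset.sum_congr rfl fun j _ => ?_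
      simp only [map_mul, map_pow, aeval_C, aeval_X, hc]
      rfl
    have h4 : (∑ j ∈ Finset.range J, C (c (i0, j)) * X ^ j) = 0 := by
      by_contra hne
      exact htr ⟨_, hne, h3⟩
    have h5 := congrArg (fun P => P.coeff j0) h4
    simp only [finsetSum_coeff, coeff_C_mul_X_pow, coeff_zero, Finset.sum_ite_eq] at h5
    rw [if_pos hj0] at h5
    apply hb0
    apply Subtype.ext
    have := hc (i0, j0)
    rw [h5, map_zero] at this
    exact this.symm
  have hQy : aeval (ρ y) Q = 0 := by
    have := congrArg ρ hK
    rw [map_zero] at this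
    rw [← this]
    simp only [Q]
    rw [map_sum, map_sum]
    refine Finset.sum_congr rfl fun i _ => ?_
    rw [map_sum ρ, map_mul, aeval_C, map_sum, Finset.sum_mul]
    refine Finset.sum_congr rfl fun j _ => ?_
    simp only [map_mul, map_pow, AlgHom.commutes, hc, aeval_X]
    rw [mul_assoc]; rfl
  have hdeg : (minpoly L (ρ y)).natDegree ≤ d :=
    (natDegree_le_of_dvd (minpoly.dvd L _ hQy) hQ0).trans hQd
  have hintL : IsIntegral L (ρ y) := Algebra.IsIntegral.isIntegral _
  have hintegral : IsIntegral ℚ_[p] (ρ y) := Algebra.IsIntegral.isIntegral _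
  let M := IntermediateField.adjoin L {ρ y}
  have : FiniteDimensional L M := IntermediateField.adjoin.finiteDimensional hintL
  have : FiniteDimensional ℚ_[p] M := FiniteDimensional.trans ℚ_[p] L M
  have : IsScalarTower ℚ_[p] M (PadicAlgCl p) := IsScalarTower.of_algebraMap_eq fun _ => rfl
  let g : M := IntermediateField.AdjoinSimple.gen L (ρ y)
  have e1 : minpoly ℚ_[p] (ρ y) = minpoly ℚ_[p] g := by
    rw [← minpoly.algebraMap_eq (algebraMap M (PadicAlgCl p)).injective g]; rfl
  have e2 : Module.finrank L M = (minpoly L (ρ y)).natDegree := IntermediateField.adjoin.finrank hintL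
  rw [e1]
  calc _ ≤ Module.finrank ℚ_[p] M := minpoly.natDegree_le g
    _ = Module.finrank ℚ_[p] L * Module.finrank L M := (Module.finrank_mul_finrank _ _ _).symm
    _ ≤ _ := by rw [e2]; exact Nat.mul_le_mul_left _ hdeg

lemma es_sub_le (p : ℕ) [Fact p.Prime] (a b : PadicAlgCl p) : ‖a - b‖ ≤ max ‖a‖ ‖b‖ := by
  rw [sub_eq_add_neg, ← norm_neg b]
  exact IsUltrametricDist.norm_add_le_max a (-b)

lemma es_delta (p : ℕ) [Fact p.Prime] (q : ℕ) (hq : 0 < q) :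
    ∃ δ : ℝ, 0 < δ ∧ δ ≤ 1 ∧ ∀ z : PadicAlgCl p, z ^ q = 1 → z ≠ 1 → δ ≤ ‖z - 1‖ := by
  classical
  have hfin : ({z : PadicAlgCl p | z ^ q = 1 ∧ z ≠ 1}).Finite := by
    refine (nthRoots q (1 : PadicAlgCl p)).toFinset.finite_toSet.subset ?_
    rintro z ⟨hz, -⟩
    simp [mem_nthRoots hq, hz]
  rcases Set.eq_empty_or_nonempty {z : PadicAlgCl p | z ^ q = 1 ∧ z ≠ 1} with h | h
  · refine ⟨1, one_pos, le_rfl, fun z hz hz1 => ?_⟩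
    have : z ∈ {z : PadicAlgCl p | z ^ q = 1 ∧ z ≠ 1} := ⟨hz, hz1⟩
    rw [h] at this; exact this.elim
  · obtain ⟨z0, hz0, hmin⟩ := hfin.exists_minimalFor (fun z => ‖z - 1‖) _ h
    refine ⟨min 1 ‖z0 - 1‖, lt_min one_pos (norm_pos_iff.mpr (sub_ne_zero.mpr hz0.2)), min_le_left _ _,
      fun z hz hz1 => (min_le_right _ _).trans ?_⟩
    by_contra! hlt
    exact absurd (hmin ⟨hz, hz1⟩ hlt.le) (not_le.mpr hlt)

lemma es_root_near (p : ℕ) [Fact p.Prime] (q : ℕ) (hq : 0 < q) (δ : ℝ) (hδ : 0 < δ)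
    (z : PadicAlgCl p) (hz : ‖z ^ q - 1‖ < δ ^ q) : ∃ ζ : PadicAlgCl p, ζ ^ q = 1 ∧ ‖z - ζ‖ < δ := by
  classical
  have : NeZero q := ⟨hq.ne'⟩
  have : NeZero (q : PadicAlgCl p) := ⟨by exact_mod_cast hq.ne'⟩
  obtain ⟨w, hw⟩ := HasEnoughRootsOfUnity.exists_primitiveRoot (PadicAlgCl p) q
  by_contra! h
  have h1 := congrArg (eval z) (X_pow_sub_one_eq_prod hq hw)
  rw [eval_prod] at h1
  simp only [eval_sub, eval_pow, eval_X, eval_one, eval_C] at h1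
  rw [h1, norm_prod] at hz
  have h2 : δ ^ q ≤ ∏ x ∈ nthRootsFinset q (1 : PadicAlgCl p), ‖z - x‖ := by
    calc δ ^ q = ∏ x ∈ nthRootsFinset q (1 : PadicAlgCl p), δ := by
          rw [Finset.prod_const, hw.card_nthRootsFinset]
      _ ≤ _ := Finset.prod_le_prod (fun _ _ => hδ.le) (fun x hx => h x ((mem_nthRootsFinset hq _).mp hx))
  exact absurd hz (not_lt.mpr h2)

lemma es_norm_gal (p : ℕ) [Fact p.Prime] (L : IntermediateField ℚ_[p] (PadicAlgCl p))
    (g : PadicAlgCl p ≃ₐ[L] PadicAlgCl p) (x : PadicAlgCl p) : ‖g x‖ = ‖x‖ :=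
  (spectralNorm_eq_of_equiv (K := ℚ_[p]) (g.restrictScalars ℚ_[p]) x).symm

lemma es_step (p : ℕ) [Fact p.Prime] (q : ℕ) (hq : 0 < q) (δ : ℝ) (hδ : 0 < δ) (hδ1 : δ ≤ 1)
    (hδz : ∀ z : PadicAlgCl p, z ^ q = 1 → z ≠ 1 → δ ≤ ‖z - 1‖)
    (L : IntermediateField ℚ_[p] (PadicAlgCl p)) (hζ : ∀ z : PadicAlgCl p, z ^ q = 1 → z ∈ L)
    (τ η : PadicAlgCl p) (hτ : τ ∈ L) (hη : η ∈ L) (hητ : η ^ q = -τ) (hτ0 : τ ≠ 0)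
    (x y : PadicAlgCl p) (hx : x ∈ L) (hsmall : ‖x / τ‖ < δ ^ q) (hxy : y ^ q + τ = x) : y ∈ L := by
  have hη0 : η ≠ 0 := by
    rintro rfl; rw [zero_pow hq.ne'] at hητ; exact hτ0 (neg_eq_zero.mp hητ.symm)
  have hz : (y / η) ^ q = 1 - x / τ := by
    rw [div_pow, hητ, ← hxy]; field_simp; ring
  have hlt1 : ‖x / τ‖ < 1 := hsmall.trans_le (pow_le_one₀ hδ.le hδ1)
  obtain ⟨ζ, hζ1, hζ2⟩ := es_root_near p q hq δ hδ (y / η) (by rw [hz]; simpa using hsmall)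
  have hζn : ‖ζ‖ = 1 := by
    have := congrArg norm hζ1
    rw [norm_pow, norm_one] at this
    exact (pow_eq_one_iff_of_nonneg (norm_nonneg _) hq.ne').mp this
  have hζ0 : ζ ≠ 0 := by rintro rfl; simp at hζn
  set w := y / η / ζ with hw
  have hwq : w ^ q = 1 - x / τ := by rw [hw, div_pow, hz, hζ1, div_one]
  have hwn : ‖w‖ = 1 := by
    have h1 : ‖(1 : PadicAlgCl p) - x / τ‖ = 1 := by
      have := IsUltrametricDist.norm_add_eq_max_of_norm_ne_norm (x := (1 : PadicAlgCl p)) (y := -(x/τ))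
        (by rw [norm_neg, norm_one]; exact hlt1.ne')
      rw [sub_eq_add_neg, this, norm_neg, norm_one, max_eq_left hlt1.le]
    rw [← hwq, norm_pow] at h1
    exact (pow_eq_one_iff_of_nonneg (norm_nonneg _) hq.ne').mp h1
  have hw0 : w ≠ 0 := by intro h; rw [h] at hwn; simp at hwn
  have hw1 : ‖w - 1‖ < δ := by
    have : w - 1 = (y / η - ζ) / ζ := by rw [hw]; field_simp
    rw [this, norm_div, hζn, div_one]; exact hζ2
  have hwL : w ∈ L := by
    have : w ∈ Set.range (algebraMap L (PadicAlgCl p)) := by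
      rw [InfiniteGalois.mem_range_algebraMap_iff_fixed]
      intro g
      have hgw : (g w) ^ q = w ^ q := by
        rw [← map_pow, hwq]
        have : (1 - x / τ) ∈ L := L.sub_mem L.one_mem (L.div_mem hx hτ)
        exact g.commutes ⟨_, this⟩
      by_contra hne
      have h1 := hδz (g w / w) (by rw [div_pow, hgw, div_self (pow_ne_zero _ hw0)])
        (by intro h; exact hne ((div_eq_one_iff_eq hw0).mp h))
      have h2 : g w / w - 1 = (g (w - 1) - (w - 1)) / w := by
        rw [map_sub, map_one]; field_simp; ring
      rw [h2, norm_div, hwn, div_one] at h1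
      have h3 := es_sub_le p (g (w - 1)) (w - 1)
      rw [es_norm_gal, max_self] at h3
      linarith
    obtain ⟨a, ha⟩ := this
    rw [← ha]; exact a.2
  have : y = w * ζ * η := by rw [hw]; field_simp
  rw [this]
  exact L.mul_mem (L.mul_mem hwL (hζ _ hζ1)) hη

lemma es_fiber_finite (p : ℕ) [Fact p.Prime] (q : ℕ) (hq : 0 < q) (τ b : PadicAlgCl p) (n : ℕ) :
    {x : PadicAlgCl p | (fun z => z ^ q + τ)^[n] x = b}.Finite := by
  classical
  induction n with
  | zero => simp
  | succ n ih =>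
    have : {x : PadicAlgCl p | (fun z => z ^ q + τ)^[n+1] x = b} = (fun z => z ^ q + τ) ⁻¹' {x : PadicAlgCl p | (fun z => z ^ q + τ)^[n] x = b} := by
      ext x; simp [Function.iterate_succ_apply]
    rw [this]
    refine ih.preimage' fun c _ => ?_
    refine (nthRoots q (c - τ)).toFinset.finite_toSet.subset ?_
    intro z hz
    simp only [Set.mem_preimage, Set.mem_singleton_iff] at hz
    simp [mem_nthRoots hq, ← hz]

lemma es_big (p : ℕ) [Fact p.Prime] (q : ℕ) (hq : 2 ≤ q) (τ : PadicAlgCl p) (hτ : 1 < ‖τ‖) (x : PadicAlgCl p)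
    (hx : ‖τ‖ < ‖x‖) (n : ℕ) : ‖τ‖ ^ n ≤ ‖(fun z => z ^ q + τ)^[n] x‖ ∧ ‖τ‖ < ‖(fun z => z ^ q + τ)^[n] x‖ := by
  have key : ∀ y : PadicAlgCl p, ‖τ‖ < ‖y‖ → ‖y ^ q + τ‖ = ‖y‖ ^ q ∧ ‖y‖ * ‖τ‖ ≤ ‖y‖ ^ q := by
    intro y hy
    have h1 : ‖y‖ * ‖τ‖ ≤ ‖y‖ ^ q := by
      calc ‖y‖ * ‖τ‖ ≤ ‖y‖ * ‖y‖ := by gcongr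
        _ = ‖y‖ ^ 2 := by ring
        _ ≤ _ := pow_le_pow_right₀ (by linarith) hq
    have h2 : ‖τ‖ < ‖y ^ q‖ := by rw [norm_pow]; nlinarith
    refine ⟨?_, h1⟩
    rw [IsUltrametricDist.norm_add_eq_max_of_norm_ne_norm h2.ne', max_eq_left h2.le, norm_pow]
  induction n with
  | zero => simp; exact ⟨by linarith, hx⟩
  | succ n ih =>
    rw [Function.iterate_succ_apply']
    obtain ⟨h1, h2⟩ := key _ ih.2
    simp only [h1]
    constructor
    · rw [pow_succ]; exact (mul_le_mul_of_nonneg_right ih.1 (by linarith)).trans h2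
    · nlinarith [ih.2]

lemma es_roots (p : ℕ) [Fact p.Prime] (q : ℕ) (hq : 2 ≤ q) (δ : ℝ) (hδ : 0 < δ) (hδ1 : δ ≤ 1)
    (hδz : ∀ z : PadicAlgCl p, z ^ q = 1 → z ≠ 1 → δ ≤ ‖z - 1‖)
    (τ : PadicAlgCl p) (hτ : 1 < ‖τ‖) (hτδ : ‖τ‖⁻¹ < (δ ^ q) ^ q) (b : PadicAlgCl p) :
    ∃ L : IntermediateField ℚ_[p] (PadicAlgCl p), FiniteDimensional ℚ_[p] L ∧ τ ∈ L ∧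
      ∀ n x, (fun z => z ^ q + τ)^[n] x = b → x ∈ L := by
  classical
  have hq0 : 0 < q := by omega
  have hτ0 : τ ≠ 0 := by rintro rfl; simp at hτ; linarith
  obtain ⟨N, hN⟩ := pow_unbounded_of_one_lt ‖b‖ hτ
  obtain ⟨η, hη⟩ := IsAlgClosed.exists_pow_nat_eq (-τ) hq0
  let S : Set (PadicAlgCl p) := (⋃ n ∈ Finset.range (N + 2), {x | (fun z => z ^ q + τ)^[n] x = b}) ∪
    ((nthRoots q (1 : PadicAlgCl p)).toFinset : Set _) ∪ {τ, η}
  have hS : S.Finite := by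
    refine Set.Finite.union (Set.Finite.union ?_ (Finset.finite_toSet _)) (by simp)
    exact Set.Finite.biUnion (Finset.finite_toSet _) fun n _ => es_fiber_finite p q hq0 τ b n
  let L := IntermediateField.adjoin ℚ_[p] S
  have hsub : S ⊆ L := IntermediateField.subset_adjoin _ _
  have hτL : τ ∈ L := hsub (by simp [S])
  have hηL : η ∈ L := hsub (by simp [S])
  refine ⟨L, ?_, hτL, ?_⟩
  · have := hS.to_subtype
    exact IntermediateField.finiteDimensional_adjoin (fun x _ => Algebra.IsIntegral.isIntegral x)
  · have hbd : ∀ n x, N ≤ n → (fun z => z ^ q + τ)^[n] x = b → ‖x‖ ≤ ‖τ‖ := by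
      intro n x hn hx
      by_contra! hlt
      have := (es_big p q hq τ hτ x hlt n).1
      rw [hx] at this
      have h2 := pow_le_pow_right₀ hτ.le hn
      linarith
    intro n
    induction n with
    | zero =>
      intro x hx
      apply hsub; left; left
      simp only [Set.mem_iUnion]
      exact ⟨0, by simp, hx⟩
    | succ n ih =>
      intro x hx
      by_cases hn : n + 1 < N + 2
      · apply hsub; left; left
        simp only [Set.mem_iUnion]
        exact ⟨n + 1, by simpa using hn, hx⟩
      · have hx' := hx
        rw [Function.iterate_succ_apply] at hx'
        have hmem := ih _ hx'
        have hn2 : ‖x ^ q + τ‖ ^ q ≤ ‖τ‖ := by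
          obtain ⟨m, rfl⟩ : ∃ m, n = m + 1 := ⟨n - 1, by omega⟩
          rw [Function.iterate_succ_apply] at hx'
          have h3 := hbd m _ (by omega) hx'
          have h4 := es_sub_le p ((x ^ q + τ) ^ q + τ) τ
          rw [add_sub_cancel_right, norm_pow] at h4
          exact h4.trans (max_le h3 le_rfl)
        refine es_step p q hq0 δ hδ hδ1 hδz L ?_ τ η hτL hηL hη hτ0 _ x hmem ?_ rfl
        · intro z hz
          apply hsub; left; right
          simp [mem_nthRoots hq0, hz]
        · refine lt_of_pow_lt_pow_left₀ q (by positivity) (lt_of_le_of_lt ?_ hτδ)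
          rw [norm_div, div_pow, inv_eq_one_div, div_le_div_iff₀ (by positivity) (by positivity), one_mul]
          calc ‖x ^ q + τ‖ ^ q * ‖τ‖ ≤ ‖τ‖ * ‖τ‖ := by gcongr
            _ = ‖τ‖ ^ 2 := by ring
            _ ≤ _ := pow_le_pow_right₀ hτ.le hq

lemma es_binom (p : ℕ) [Fact p.Prime] (r : ℕ) (x y : PadicAlgCl p) (hx : ‖x‖ ≤ 1) (hy : ‖y‖ ≤ 1) :
    ‖x ^ (p ^ r) - y ^ (p ^ r) - (x - y) ^ (p ^ r)‖ ≤ (p : ℝ)⁻¹ * ‖x - y‖ := by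
  have hh : ‖x - y‖ ≤ 1 := (es_sub_le p x y).trans (max_le hx hy)
  have h := (Commute.all (x - y) y).add_pow_prime_pow_eq' (Fact.out : p.Prime) r
  rw [sub_add_cancel] at h
  rw [h]
  have hn : ‖(p : PadicAlgCl p)‖ = (p : ℝ)⁻¹ := by
    have := PadicAlgCl.norm_extends p (p : ℚ_[p])
    rw [Padic.norm_p] at this
    simpa using this
  have e : ∀ a b c : PadicAlgCl p, a + b + c - b - a = c := fun a b c => by ring
  rw [e, norm_mul, hn]
  gcongr
  refine IsUltrametricDist.norm_sum_le_of_forall_le_of_nonneg (norm_nonneg _) fun k hk => ?_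
  rw [Finset.mem_Ioo] at hk
  rw [norm_mul, norm_mul, norm_pow, norm_pow]
  have h1 : ‖x - y‖ ^ k ≤ ‖x - y‖ := pow_le_of_le_one (norm_nonneg _) hh (by omega)
  have h2 : ‖y‖ ^ (p ^ r - k) ≤ 1 := pow_le_one₀ (norm_nonneg _) hy
  have h3 := IsUltrametricDist.norm_natCast_le_one (PadicAlgCl p) ((p ^ r).choose k / p)
  calc _ ≤ ‖x - y‖ * 1 * 1 := by gcongr
    _ = _ := by ring

lemma es_p_lt (p : ℕ) [Fact p.Prime] : (p : ℝ)⁻¹ < 1 :=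
  inv_lt_one_of_one_lt₀ (by exact_mod_cast (Fact.out : p.Prime).one_lt)

lemma es_contract (p : ℕ) [Fact p.Prime] (r : ℕ) (hr : 1 ≤ r) (τ x y : PadicAlgCl p) (hx : ‖x‖ ≤ 1)
    (hy : ‖y‖ ≤ 1) (hne : x ≠ y) (hlt : ‖x - y‖ < 1) :
    ‖(x ^ (p ^ r) + τ) - (y ^ (p ^ r) + τ)‖ < ‖x - y‖ := by
  have h := es_binom p r x y hx hy
  have hpos : 0 < ‖x - y‖ := norm_pos_iff.mpr (sub_ne_zero.mpr hne)
  have hq : 2 ≤ p ^ r := (Fact.out : p.Prime).two_le.trans (Nat.le_self_pow (by omega) p)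
  have e : (x ^ (p ^ r) + τ) - (y ^ (p ^ r) + τ) =
    (x ^ (p ^ r) - y ^ (p ^ r) - (x - y) ^ (p ^ r)) + (x - y) ^ (p ^ r) := by ring
  rw [e]
  refine (IsUltrametricDist.norm_add_le_max _ _).trans_lt (max_lt ?_ ?_)
  · refine h.trans_lt ?_
    have := es_p_lt p
    nlinarith
  · rw [norm_pow]
    calc ‖x - y‖ ^ (p ^ r) ≤ ‖x - y‖ ^ 2 := pow_le_pow_of_le_one hpos.le hlt.le hq
      _ < _ := by nlinarith

lemma es_injmod (p : ℕ) [Fact p.Prime] (r : ℕ) (τ x y : PadicAlgCl p) (hx : ‖x‖ ≤ 1)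
    (hy : ‖y‖ ≤ 1) (hlt : ‖(x ^ (p ^ r) + τ) - (y ^ (p ^ r) + τ)‖ < 1) : ‖x - y‖ < 1 := by
  have h := es_binom p r x y hx hy
  have hh : ‖x - y‖ ≤ 1 := (es_sub_le p x y).trans (max_le hx hy)
  have hq : p ^ r ≠ 0 := pow_ne_zero _ (Fact.out : p.Prime).ne_zero
  have e : (x - y) ^ (p ^ r) = ((x ^ (p ^ r) + τ) - (y ^ (p ^ r) + τ)) -
    (x ^ (p ^ r) - y ^ (p ^ r) - (x - y) ^ (p ^ r)) := by ring
  have h2 : ‖(x - y) ^ (p ^ r)‖ < 1 := by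
    rw [e]
    refine (es_sub_le p _ _).trans_lt (max_lt hlt (h.trans_lt ?_))
    have := es_p_lt p
    have : 0 ≤ (p : ℝ)⁻¹ := by positivity
    nlinarith
  rw [norm_pow] at h2
  by_contra! h3
  exact absurd (one_le_pow₀ h3) (not_le.mpr h2)

lemma es_iter_le (p : ℕ) [Fact p.Prime] (q : ℕ) (τ : PadicAlgCl p) (hτ : ‖τ‖ ≤ 1) (x : PadicAlgCl p)
    (hx : ‖x‖ ≤ 1) (n : ℕ) : ‖(fun z => z ^ q + τ)^[n] x‖ ≤ 1 := by
  induction n with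
  | zero => simpa using hx
  | succ n ih =>
    rw [Function.iterate_succ_apply']
    refine (IsUltrametricDist.norm_add_le_max _ _).trans (max_le ?_ hτ)
    rw [norm_pow]
    exact pow_le_one₀ (norm_nonneg _) ih

lemma es_iter_gt (p : ℕ) [Fact p.Prime] (q : ℕ) (hq : q ≠ 0) (τ : PadicAlgCl p) (hτ : ‖τ‖ ≤ 1)
    (x : PadicAlgCl p) (hx : 1 < ‖x‖) (n : ℕ) : 1 < ‖(fun z => z ^ q + τ)^[n] x‖ := by
  induction n with
  | zero => simpa using hx
  | succ n ih =>
    rw [Function.iterate_succ_apply']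
    have h1 := one_lt_pow₀ ih hq
    rw [← norm_pow] at h1
    have h2 := hτ.trans_lt h1
    change 1 < ‖((fun z => z ^ q + τ)^[n] x) ^ q + τ‖
    rw [IsUltrametricDist.norm_add_eq_max_of_norm_ne_norm h2.ne', max_eq_left h2.le]
    exact h1

lemma es_iter_injmod (p : ℕ) [Fact p.Prime] (r : ℕ) (τ : PadicAlgCl p) (hτ : ‖τ‖ ≤ 1) (n : ℕ) :
    ∀ x y : PadicAlgCl p, ‖x‖ ≤ 1 → ‖y‖ ≤ 1 →
    ‖(fun z => z ^ (p ^ r) + τ)^[n] x - (fun z => z ^ (p ^ r) + τ)^[n] y‖ < 1 → ‖x - y‖ < 1 := by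
  induction n with
  | zero => intro x y _ _ h; simpa using h
  | succ n ih =>
    intro x y hx hy h
    rw [Function.iterate_succ_apply, Function.iterate_succ_apply] at h
    exact es_injmod p r τ x y hx hy
      (ih _ _ (es_iter_le p _ τ hτ x hx 1) (es_iter_le p _ τ hτ y hy 1) h)

lemma es_iter_contract (p : ℕ) [Fact p.Prime] (r : ℕ) (hr : 1 ≤ r) (τ : PadicAlgCl p) (hτ : ‖τ‖ ≤ 1) (n : ℕ)
    (x y : PadicAlgCl p) (hx : ‖x‖ ≤ 1) (hy : ‖y‖ ≤ 1) (hlt : ‖x - y‖ < 1) :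
    ‖(fun z => z ^ (p ^ r) + τ)^[n] x - (fun z => z ^ (p ^ r) + τ)^[n] y‖ ≤ ‖x - y‖ ∧
    (1 ≤ n → x ≠ y →
      ‖(fun z => z ^ (p ^ r) + τ)^[n] x - (fun z => z ^ (p ^ r) + τ)^[n] y‖ < ‖x - y‖) := by
  induction n with
  | zero => simp
  | succ n ih =>
    rw [Function.iterate_succ_apply', Function.iterate_succ_apply']
    set a := (fun z => z ^ (p ^ r) + τ)^[n] x
    set b := (fun z => z ^ (p ^ r) + τ)^[n] y
    by_cases hab : a = b
    · rw [hab, sub_self, norm_zero]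
      exact ⟨norm_nonneg _, fun _ h => norm_pos_iff.mpr (sub_ne_zero.mpr h)⟩
    · have := (es_contract p r hr τ a b (es_iter_le p _ τ hτ x hx n) (es_iter_le p _ τ hτ y hy n) hab
        (ih.1.trans_lt hlt)).trans_le ih.1
      exact ⟨this.le, fun _ _ => this⟩

lemma es_pigeon (p : ℕ) [Fact p.Prime] (V : Submodule ℚ_[p] (PadicAlgCl p)) [FiniteDimensional ℚ_[p] V]
    (u : ℕ → PadicAlgCl p) (hu : ∀ n, u n ∈ V) (hb : ∀ n, ‖u n‖ ≤ 1) : ∃ i j, i < j ∧ ‖u i - u j‖ < 1 := by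
  have : ProperSpace V := FiniteDimensional.proper ℚ_[p] V
  let v : ℕ → V := fun n => ⟨u n, hu n⟩
  obtain ⟨a, -, φ, hφ, hlim⟩ := tendsto_subseq_of_bounded (x := v) (Metric.isBounded_closedBall (x := 0) (r := 1))
    (fun n => by simpa [v] using hb n)
  obtain ⟨N, hN⟩ := Metric.cauchySeq_iff'.mp hlim.cauchySeq 1 one_pos
  refine ⟨φ N, φ (N + 1), hφ (Nat.lt_succ_self N), ?_⟩
  have := hN (N + 1) (Nat.le_succ N)
  rw [dist_comm, dist_eq_norm] at this
  exact this

lemma es_recur (p : ℕ) [Fact p.Prime] (r : ℕ) (hr : 1 ≤ r) (τ : PadicAlgCl p) (hτ : ‖τ‖ ≤ 1)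
    (B : PadicAlgCl p) (hB : ‖B‖ ≤ 1) (L : IntermediateField ℚ_[p] (PadicAlgCl p)) [FiniteDimensional ℚ_[p] L]
    (hτL : τ ∈ L) (hBL : B ∈ L) (hper : ∀ n, 1 ≤ n → (fun z => z ^ (p ^ r) + τ)^[n] B ≠ B) :
    ∃ m c, 1 ≤ m ∧ 0 < c ∧ c < 1 ∧ ∀ k, 1 ≤ k → ‖(fun z => z ^ (p ^ r) + τ)^[m * k] B - B‖ = c := by
  set F := (fun z : PadicAlgCl p => z ^ (p ^ r) + τ) with hF
  have hle := es_iter_le p (p ^ r) τ hτ B hB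
  have hV : FiniteDimensional ℚ_[p] (Subalgebra.toSubmodule L.toSubalgebra) := ‹FiniteDimensional ℚ_[p] L›
  obtain ⟨i, j, hij, h⟩ := es_pigeon p (Subalgebra.toSubmodule L.toSubalgebra) (fun n => F^[n] B) (by
    intro n
    change F^[n] B ∈ L
    induction n with
    | zero => exact hBL
    | succ n ih => rw [Function.iterate_succ_apply']; exact L.add_mem (pow_mem ih _) hτL) hle
  obtain ⟨m, rfl⟩ : ∃ m, j = i + m := ⟨j - i, by omega⟩
  have hm : 1 ≤ m := by omega
  have h1 : ‖F^[m] B - B‖ < 1 := by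
    rw [norm_sub_rev]
    simp only [Function.iterate_add_apply] at h
    exact es_iter_injmod p r τ hτ i _ _ hB (hle m) h
  have hne := hper m hm
  refine ⟨m, ‖F^[m] B - B‖, hm, norm_pos_iff.mpr (sub_ne_zero.mpr hne), h1, ?_⟩
  intro k hk
  induction k, hk using Nat.le_induction with
  | base => simp
  | succ k hk ih =>
    have e : m * (k + 1) = m + m * k := by ring
    rw [e, Function.iterate_add_apply]
    have hneq : F^[m * k] B ≠ B := hper _ (Nat.mul_pos hm hk)
    have h2 := (es_iter_contract p r hr τ hτ m (F^[m * k] B) B (hle _) hB (by rw [ih]; exact h1)).2 hm hneq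
    rw [ih] at h2
    have e2 : F^[m] (F^[m * k] B) - B = (F^[m] (F^[m * k] B) - F^[m] B) + (F^[m] B - B) := by ring
    rw [e2, IsUltrametricDist.norm_add_eq_max_of_norm_ne_norm h2.ne, max_eq_right h2.le]

lemma es_count {K : Type*} [Field K] (v : K →* ℝ) (hv : ∀ x, 0 ≤ v x) (h : K[X]) (hm : h.Monic) (b : K)
    (c : ℝ) (H : ∀ g : K[X], g.Monic → Irreducible g → g ∣ h → v (g.eval b) ≤ c) :
    v (h.eval b) ≤ c ^ (UniqueFactorizationMonoid.factors h).card := by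
  classical
  have hc : Multiset.card (UniqueFactorizationMonoid.normalizedFactors h) =
      (UniqueFactorizationMonoid.factors h).card := by
    rw [UniqueFactorizationMonoid.normalizedFactors, Multiset.card_map]
  have hp : (UniqueFactorizationMonoid.normalizedFactors h).prod = h := by
    rw [UniqueFactorizationMonoid.prod_normalizedFactors_eq hm.ne_zero, hm.normalize_eq_self]
  have key : ∀ s : Multiset K[X], (∀ g ∈ s, v (g.eval b) ≤ c) → v (s.prod.eval b) ≤ c ^ s.card := by
    intro s
    induction s using Multiset.induction with
    | empty => simp
    | cons a s ih =>
      intro hs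
      rw [Multiset.prod_cons, eval_mul, map_mul, Multiset.card_cons, pow_succ']
      have h1 := hs a (Multiset.mem_cons_self a s)
      exact mul_le_mul h1 (ih fun g hg => hs g (Multiset.mem_cons_of_mem hg)) (hv _) ((hv _).trans h1)
  have := key (UniqueFactorizationMonoid.normalizedFactors h) fun g hg => by
    have hi := UniqueFactorizationMonoid.irreducible_of_normalized_factor g hg
    refine H g ?_ hi (UniqueFactorizationMonoid.dvd_of_mem_normalizedFactors hg)
    rw [← UniqueFactorizationMonoid.normalize_normalized_factor g hg]
    exact Polynomial.monic_normalize hi.ne_zero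
  rwa [hp, hc] at this

lemma es_eval_prod {K Ω : Type*} [Field K] [Field Ω] [IsAlgClosed Ω] (σ : K →+* Ω) (g : K[X]) (hg : g.Monic)
    (b : K) : σ (g.eval b) = (((g.map σ).roots).map fun x => σ b - x).prod := by
  rw [← eval_map_apply]
  exact (IsAlgClosed.splits (g.map σ)).eval_eq_prod_roots_of_monic (hg.map σ) _

lemma es_root_dvd {K Ω : Type*} [Field K] [Field Ω] (σ : K →+* Ω) (g h : K[X])
    (hd : g ∣ h) (x : Ω) (hx : x ∈ (g.map σ).roots) : h.eval₂ σ x = 0 := by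
  have h1 := isRoot_of_mem_roots hx
  obtain ⟨k, rfl⟩ := hd
  rw [IsRoot.def, eval_map] at h1
  rw [eval₂_mul, h1, zero_mul]

lemma es_iter_eval {K Ω : Type*} [Field K] [Field Ω] (σ : K →+* Ω) (q : ℕ) (t : K) (n : ℕ) (x : Ω) :
    (polyIter (X ^ q + C t) n).eval₂ σ x = (fun z => z ^ q + σ t)^[n] x := by
  induction n with
  | zero => simp [polyIter]
  | succ n ih =>
    rw [polyIter, Function.iterate_succ_apply', ← ih]
    simp [eval₂_pow]

lemma es_iter_monic {K : Type*} [Field K] (q : ℕ) (hq : 1 ≤ q) (t : K) (n : ℕ) :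
    (polyIter (X ^ q + C t) n).Monic ∧ (polyIter (X ^ q + C t) n).natDegree = q ^ n := by
  have hd : (X ^ q + C t : K[X]).natDegree = q := natDegree_X_pow_add_C
  have hm : (X ^ q + C t : K[X]).Monic := monic_X_pow_add_C t (by omega)
  induction n with
  | zero => simp [polyIter]
  | succ n ih =>
    rw [polyIter]
    constructor
    · exact hm.comp ih.1 (by rw [ih.2]; positivity)
    · rw [natDegree_comp, hd, ih.2, pow_succ']

lemma es_monic {K : Type*} [Field K] (q : ℕ) (hq : 1 ≤ q) (t β : K) (n : ℕ) :
    (polyIter (X ^ q + C t) n - C β).Monic := by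
  obtain ⟨h1, h2⟩ := es_iter_monic q hq t n
  refine h1.sub_of_left ?_
  refine degree_C_le.trans_lt ?_
  rw [← natDegree_pos_iff_degree_pos, h2]; positivity

lemma es_core (p : ℕ) [Fact p.Prime] (r : ℕ) (hr : 1 ≤ r) {K : Type*} [Field K] (t β : K)
    (σ ρ : K →+* PadicAlgCl p) (L : IntermediateField ℚ_[p] (PadicAlgCl p)) (D : ℕ)
    (hσt : σ t ∈ L) (hL : ∀ n x, (fun z => z ^ (p ^ r) + σ t)^[n] x = σ β → x ∈ L)
    (hD : ∀ y, σ y ∈ L → ‖ρ y‖ < 1 → ‖ρ y‖ ^ D ≤ (p : ℝ)⁻¹) (hρ : ‖ρ t‖ ≤ 1)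
    (hβ : ¬ ∃ n : ℕ, 1 ≤ n ∧ (polyIter (X ^ (p ^ r) + C t) n).eval β = β) :
    ∃ B : ℕ, ∀ n : ℕ, 1 ≤ n →
      (UniqueFactorizationMonoid.factors (polyIter (X ^ (p ^ r) + C t) n - C β)).card ≤ B := by
  have hq : 1 ≤ p ^ r := Nat.one_le_pow _ _ (Fact.out : p.Prime).pos
  have hp0 : (0 : ℝ) < (p : ℝ)⁻¹ := by
    have := (Fact.out : p.Prime).pos
    positivity
  -- reduce to a uniform lower bound
  suffices h : ∃ c : ℝ, 0 < c ∧ ∀ n : ℕ, 1 ≤ n →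
      c ≤ ((p : ℝ)⁻¹) ^ (UniqueFactorizationMonoid.factors (polyIter (X ^ (p ^ r) + C t) n - C β)).card by
    obtain ⟨c, hc, h⟩ := h
    obtain ⟨B, hB⟩ := exists_pow_lt_of_lt_one hc (es_p_lt p)
    refine ⟨B, fun n hn => ?_⟩
    by_contra! hlt
    have h1 := pow_le_pow_of_le_one hp0.le (es_p_lt p).le hlt.le
    linarith [h n hn]
  have hmem : ∀ n (g : K[X]), g.Monic → g ∣ polyIter (X ^ (p ^ r) + C t) n - C β → ∀ b, σ b ∈ L →
      σ (g.eval b) ∈ L := by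
    intro n g hg hd b hb
    rw [es_eval_prod σ g hg b]
    refine multiset_prod_mem _ fun y hy => ?_
    obtain ⟨x, hx, rfl⟩ := Multiset.mem_map.mp hy
    refine L.sub_mem hb (hL n x ?_)
    have := es_root_dvd σ g _ hd x hx
    rw [eval₂_sub, eval₂_C, es_iter_eval, sub_eq_zero] at this
    exact this
  have hroot : ∀ n (g : K[X]), g ∣ polyIter (X ^ (p ^ r) + C t) n - C β → ∀ x ∈ (g.map ρ).roots,
      (fun z => z ^ (p ^ r) + ρ t)^[n] x = ρ β := by
    intro n g hd x hx
    have := es_root_dvd ρ g _ hd x hx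
    rw [eval₂_sub, eval₂_C, es_iter_eval, sub_eq_zero] at this
    exact this
  have hne : ∀ g : K[X], g.Monic → Irreducible g → (g.map ρ).roots ≠ 0 := by
    intro g hg hi h0
    have h1 := (IsAlgClosed.splits (g.map ρ)).natDegree_eq_card_roots
    rw [h0, Multiset.card_zero, natDegree_map] at h1
    exact absurd h1 (Irreducible.natDegree_pos hi).ne'
  -- multiplicative norm
  have hprod : ∀ (s : Multiset (PadicAlgCl p)), s ≠ 0 → (∀ x ∈ s, ‖x‖ < 1) → ‖s.prod‖ < 1 := by
    intro s
    induction s using Multiset.induction with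
    | empty => intro h; exact absurd rfl h
    | cons a s ih =>
      intro _ hs
      rw [Multiset.prod_cons, norm_mul]
      have h1 := hs a (Multiset.mem_cons_self a s)
      by_cases h0 : s = 0
      · simpa [h0] using h1
      · have h2 := ih h0 fun x hx => hs x (Multiset.mem_cons_of_mem hx)
        nlinarith [norm_nonneg a, norm_nonneg s.prod]
  let w : K →* ℝ := ((powMonoidHom D).comp (normHom : PadicAlgCl p →*₀ ℝ).toMonoidHom).comp (ρ : K →* PadicAlgCl p)
  have hw : ∀ x, w x = ‖ρ x‖ ^ D := fun x => rfl
  rcases lt_or_ge 1 ‖ρ β‖ with hB | hB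
  · have hρβ : ρ β ≠ 0 := by intro h; rw [h, norm_zero] at hB; linarith
    refine ⟨(‖ρ β‖⁻¹) ^ D, by positivity, fun n hn => ?_⟩
    let v : K →* ℝ := (invMonoidWithZeroHom : ℝ →*₀ ℝ).toMonoidHom.comp w
    have hv : ∀ x, v x = (‖ρ x‖ ^ D)⁻¹ := fun x => rfl
    have := es_count v (fun x => by rw [hv]; positivity) _ (es_monic (p ^ r) hq t β n) 0 ((p : ℝ)⁻¹) (by
      intro g hg hi hd
      have h1 := hmem n g hg hd 0 (by rw [map_zero]; exact L.zero_mem)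
      have h2 := hD ((g.eval 0)⁻¹) (by rw [map_inv₀]; exact L.inv_mem h1) (by
        rw [map_inv₀, es_eval_prod ρ g hg 0, ← Multiset.prod_map_inv']
        refine hprod _ ?_ ?_
        · simpa using hne g hg hi
        · intro x hx
          simp only [Multiset.map_map, Multiset.mem_map, Function.comp] at hx
          obtain ⟨y, hy, rfl⟩ := hx
          rw [map_zero, zero_sub, norm_inv, norm_neg]
          apply inv_lt_one_of_one_lt₀
          by_contra! h
          have := es_iter_le p (p ^ r) (ρ t) hρ y h n
          rw [hroot n g hd y hy] at this
          linarith)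
      rw [hv, ← inv_pow, ← norm_inv, ← map_inv₀]
      exact h2)
    refine le_trans (le_of_eq ?_) this
    rw [hv, inv_pow]
    congr 2
    have e : ρ ((polyIter (X ^ (p ^ r) + C t) n - C β).eval 0) =
        (fun z => z ^ (p ^ r) + ρ t)^[n] 0 - ρ β := by
      rw [eval_sub, eval_C, map_sub, ← es_iter_eval ρ, ← map_zero ρ, eval₂_at_apply]
    have h0 := es_iter_le p (p ^ r) (ρ t) hρ 0 (by simp) n
    rw [e, sub_eq_add_neg, IsUltrametricDist.norm_add_eq_max_of_norm_ne_norm, norm_neg, max_eq_right]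
    · linarith
    · rw [norm_neg]; linarith
  · let L' := IntermediateField.adjoin ℚ_[p] ({ρ t, ρ β} : Set (PadicAlgCl p))
    have hL' : FiniteDimensional ℚ_[p] L' :=
      IntermediateField.finiteDimensional_adjoin (fun x _ => Algebra.IsIntegral.isIntegral x)
    have hev : ∀ (τ : K →+* PadicAlgCl p) n b, τ ((polyIter (X ^ (p ^ r) + C t) n).eval b) =
        (fun z => z ^ (p ^ r) + τ t)^[n] (τ b) := by
      intro τ n b
      rw [← es_iter_eval τ, eval₂_at_apply]
    obtain ⟨m, c, hm, hc, hc1, hmc⟩ := es_recur p r hr (ρ t) hρ (ρ β) hB L'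
      (IntermediateField.subset_adjoin _ _ (by simp)) (IntermediateField.subset_adjoin _ _ (by simp)) (by
        intro n hn h
        rw [← hev ρ] at h
        exact hβ ⟨n, hn, ρ.injective h⟩)
    refine ⟨c ^ D, by positivity, fun n hn => ?_⟩
    set b := (polyIter (X ^ (p ^ r) + C t) (m * n - n)).eval β with hb
    have hmn : m * n = n + (m * n - n) := by
      have : n ≤ m * n := Nat.le_mul_of_pos_left n hm
      omega
    have hσb : σ b ∈ L := by
      rw [hb, hev σ]
      have hσβ : σ β ∈ L := hL 0 _ rfl
      generalize m * n - n = k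
      induction k with
      | zero => exact hσβ
      | succ k ih => rw [Function.iterate_succ_apply']; exact L.add_mem (pow_mem ih _) hσt
    have hρb : ‖ρ b‖ ≤ 1 := by rw [hb, hev ρ]; exact es_iter_le p _ _ hρ _ hB _
    have hnb : ‖(fun z => z ^ (p ^ r) + ρ t)^[n] (ρ b) - ρ β‖ = c := by
      rw [hb, hev ρ, ← Function.iterate_add_apply, ← hmn]
      exact hmc n hn
    have := es_count w (fun x => by rw [hw]; positivity) _ (es_monic (p ^ r) hq t β n) b ((p : ℝ)⁻¹) (by
      intro g hg hi hd
      rw [hw]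
      refine hD _ (hmem n g hg hd b hσb) ?_
      rw [es_eval_prod ρ g hg b]
      refine hprod _ ?_ ?_
      · simpa using hne g hg hi
      · intro x hx
        obtain ⟨y, hy, rfl⟩ := Multiset.mem_map.mp hx
        have hy1 := hroot n g hd y hy
        refine es_iter_injmod p r (ρ t) hρ n _ _ hρb ?_ ?_
        · by_contra! h
          have := es_iter_gt p (p ^ r) (by omega) (ρ t) hρ y h n
          rw [hy1] at this
          linarith
        · rw [hy1, hnb]; exact hc1)
    refine le_trans (le_of_eq ?_) this
    rw [hw, eval_sub, eval_C, map_sub, hev ρ, hnb]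
/-- for `f = X^q + t` with `q = p^r` a prime power and `t` non-constant in a
function field `K` over `Qbar`, and `β ∈ K` not periodic for `f`, the pair `(f, β)` is
eventually stable over `K`: the number of irreducible factors (with multiplicity) of
`f^n(X) - β` is bounded uniformly in `n`. -/
theorem stmt_1 (p r : ℕ) (hp : p.Prime) (hr : 1 ≤ r)
    (K : Type*) [Field K] [Algebra (RatFunc (AlgebraicClosure ℚ)) K]
    [FunctionField (AlgebraicClosure ℚ) K]
    (t : K)
    (ht : t ∉ Set.range fun a : AlgebraicClosure ℚ =>
      algebraMap (RatFunc (AlgebraicClosure ℚ)) K (RatFunc.C a))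
    (f : K[X]) (hf : f = X ^ (p ^ r) + C t) (β : K)
    (hβ : ¬ ∃ n : ℕ, 1 ≤ n ∧ (polyIter f n).eval β = β) :
    ∃ B : ℕ, ∀ n : ℕ, 1 ≤ n →
      (UniqueFactorizationMonoid.factors (polyIter f n - C β)).card ≤ B := by
  subst hf
  have hpf : Fact p.Prime := ⟨hp⟩
  have hq : 2 ≤ p ^ r := hp.two_le.trans (Nat.le_self_pow (by omega) p)
  let algK : Algebra (AlgebraicClosure ℚ) K :=
    ((algebraMap (RatFunc (AlgebraicClosure ℚ)) K).comp
      (algebraMap (AlgebraicClosure ℚ) (RatFunc (AlgebraicClosure ℚ)))).toAlgebra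
  have : IsScalarTower (AlgebraicClosure ℚ) (RatFunc (AlgebraicClosure ℚ)) K :=
    IsScalarTower.of_algebraMap_eq fun x => rfl
  have htr : Transcendental (AlgebraicClosure ℚ) t := by
    intro halg
    have h1 : IsIntegral (AlgebraicClosure ℚ) t := halg.isIntegral
    obtain ⟨a, ha⟩ := (minpoly.mem_range_of_degree_eq_one (AlgebraicClosure ℚ) t
      (IsAlgClosed.degree_eq_one_of_irreducible _ (minpoly.irreducible h1)))
    exact ht ⟨a, ha⟩
  have := es_finite t htr
  have hAalg : Algebra.IsAlgebraic ℚ (AlgebraicClosure ℚ) := by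
    have h := AlgebraicClosure.isAlgebraic ℚ
    have e : (AlgebraicClosure.instAlgebra ℚ : Algebra ℚ (AlgebraicClosure ℚ)) =
        DivisionRing.toRatAlgebra := Subsingleton.elim _ _
    rw [← e]
    exact h
  have hAint : Algebra.IsIntegral ℚ (AlgebraicClosure ℚ) := Algebra.IsAlgebraic.isIntegral
  let ι : AlgebraicClosure ℚ →ₐ[ℚ] PadicAlgCl p := IsAlgClosed.lift
  let algΩ : Algebra (AlgebraicClosure ℚ) (PadicAlgCl p) := ι.toRingHom.toAlgebra
  have hsc : IsScalarTower ℚ (AlgebraicClosure ℚ) (PadicAlgCl p) :=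
    IsScalarTower.of_algebraMap_eq fun x => (ι.commutes x).symm
  have hA : ∀ x : PadicAlgCl p, IsIntegral ℚ x ↔
      ∃ a, algebraMap (AlgebraicClosure ℚ) (PadicAlgCl p) a = x := by
    intro x
    constructor
    · intro hx
      have h1 : IsIntegral (AlgebraicClosure ℚ) x := hx.tower_top
      exact minpoly.mem_range_of_degree_eq_one (AlgebraicClosure ℚ) x
        (IsAlgClosed.degree_eq_one_of_irreducible _ (minpoly.irreducible h1))
    · rintro ⟨a, rfl⟩
      exact (Algebra.IsIntegral.isIntegral (R := ℚ) a).map ι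
  have htrans : ∀ x : PadicAlgCl p, Transcendental ℚ x → Transcendental (AlgebraicClosure ℚ) x := by
    intro x hx halg
    have h1 : IsIntegral (AlgebraicClosure ℚ) x := halg.isIntegral
    exact hx (isIntegral_trans (R := ℚ) x h1).isAlgebraic
  obtain ⟨u, hu, hu1⟩ := es_exists_transc p
  have hu0 : u ≠ 0 := by rintro rfl; exact hu isAlgebraic_zero
  set u' : PadicAlgCl p := algebraMap ℚ_[p] (PadicAlgCl p) u with hu'
  have hu'n : ‖u'‖ = ‖u‖ := PadicAlgCl.norm_extends p u
  have hu't : Transcendental ℚ u' := by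
    intro h
    exact hu ((isAlgebraic_algebraMap_iff (algebraMap ℚ_[p] (PadicAlgCl p)).injective).mp h)
  have hupos : 0 < ‖u‖ := norm_pos_iff.mpr hu0
  obtain ⟨δ, hδ, hδ1, hδz⟩ := es_delta p (p ^ r) (by omega)
  obtain ⟨N, hN⟩ := exists_pow_lt_of_lt_one (show 0 < (δ ^ (p ^ r)) ^ (p ^ r) by positivity) hu1
  set τ : PadicAlgCl p := (u' ^ (N + 1))⁻¹ with hτ
  have hτn : ‖τ‖ = (‖u‖ ^ (N + 1))⁻¹ := by rw [hτ, norm_inv, norm_pow, hu'n]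
  have hτt : Transcendental ℚ τ := by
    intro h
    have h1 := h.inv
    rw [hτ, inv_inv] at h1
    exact hu't (IsAlgebraic.of_pow (Nat.succ_pos N) h1)
  have hτ1 : 1 < ‖τ‖ := by
    rw [hτn]
    exact (one_lt_inv₀ (by positivity)).mpr (pow_lt_one₀ hupos.le hu1 (Nat.succ_ne_zero N))
  have hτδ : ‖τ‖⁻¹ < (δ ^ (p ^ r)) ^ (p ^ r) := by
    rw [hτn, inv_inv]
    exact (pow_le_pow_of_le_one hupos.le hu1.le (Nat.le_succ N)).trans_lt hN
  obtain ⟨σ, hσ⟩ := es_embed t htr τ (htrans τ hτt)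
  obtain ⟨ρ, hρ⟩ := es_embed t htr u' (htrans u' hu't)
  obtain ⟨L, hfin, hτL, hL⟩ := es_roots p (p ^ r) hq δ hδ hδ1 hδz τ hτ1 hτδ (σ β)
  refine es_core p r hr t β (σ : K →+* PadicAlgCl p) (ρ : K →+* PadicAlgCl p) L
    (Module.finrank ℚ_[p] L * Module.finrank (IntermediateField.adjoin (AlgebraicClosure ℚ) {t}) K)
    ?_ ?_ ?_ ?_ hβ
  · change σ t ∈ L
    rw [hσ]; exact hτL
  · change ∀ n x, (fun z => z ^ (p ^ r) + σ t)^[n] x = σ β → x ∈ L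
    rw [hσ]; exact hL
  · intro y hy hlt
    refine es_discrete p _ _ ?_ hlt
    exact es_degree p hA t σ ρ L (by rw [hσ]; exact hτL)
      (by rw [hρ]; exact L.algebraMap_mem u) (by rw [hρ]; exact htrans u' hu't) y hy
  · change ‖ρ t‖ ≤ 1
    rw [hρ, hu'n]; exact hu1.le
end

section
/- Let d ≥ 2 be an integer, let K be a function field of one variable over the algebraic closure Qbar of ℚ with fixed algebraic closure Ω, let c ∈ K, f = X^d + C c ∈ K[X], and β ∈ K. Set K_0(β) = K and, for n ≥ 1, let K_n(β) be the intermediate field of Ω/K generated over K by all roots in Ω of f^n(X) − β. If β is periodic for f or postcritical for f, then for infinitely many n the degree [K_n(β) : K_{n−1}(β)] is strictly less than d^(d^(n−1)). -/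
open Polynomial

/-- `preimField K Ω f β n` is the intermediate field of `Ω/K` generated over `K` by all roots
in `Ω` of `f^n(X) - β`. -/
noncomputable def preimField (K Ω : Type*) [Field K] [Field Ω] [Algebra K Ω]
    (f : K[X]) (β : K) (n : ℕ) : IntermediateField K Ω :=
  IntermediateField.adjoin K {x : Ω | Polynomial.aeval x (polyIter f n) = algebraMap K Ω β}

section helpers

variable {K Ω : Type*} [Field K] [Field Ω] [Algebra K Ω]

theorem aux_finrank_one (d : ℕ) (hd : 0 < d) (L : IntermediateField K Ω) (y : Ω)
    (hy : y ^ d ∈ L) :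
    Module.finrank K ↥(L ⊔ IntermediateField.adjoin K {y}) ≤ d * Module.finrank K L := by
  rw [← IntermediateField.restrictScalars_adjoin_eq_sup]
  have h1 : Module.finrank K L * Module.finrank L (IntermediateField.adjoin L {y}) =
      Module.finrank K (IntermediateField.adjoin L {y}) := Module.finrank_mul_finrank _ _ _
  change Module.finrank K (IntermediateField.adjoin L {y}) ≤ _
  rw [← h1, mul_comm]
  apply Nat.mul_le_mul_right
  have hne : (X ^ d - C (⟨y ^ d, hy⟩ : L)) ≠ 0 := X_pow_sub_C_ne_zero hd _
  have hr : Polynomial.aeval y (X ^ d - C (⟨y ^ d, hy⟩ : L)) = 0 := by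
    simp [IntermediateField.algebraMap_apply]
  have hint : IsIntegral L y := ⟨_, monic_X_pow_sub_C _ hd.ne', hr⟩
  rw [IntermediateField.adjoin.finrank hint]
  calc (minpoly L y).natDegree ≤ (X ^ d - C (⟨y ^ d, hy⟩ : L)).natDegree :=
        natDegree_le_of_dvd (minpoly.dvd L y hr) hne
    _ = d := natDegree_X_pow_sub_C

theorem aux_finrank (d : ℕ) (hd : 0 < d) [DecidableEq Ω] (T : Finset Ω) :
    ∀ L : IntermediateField K Ω, (∀ y ∈ T, y ^ d ∈ L) →
    Module.finrank K ↥(L ⊔ IntermediateField.adjoin K (T : Set Ω)) ≤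
      d ^ T.card * Module.finrank K L := by
  induction T using Finset.induction_on with
  | empty =>
    intro L _
    have e : L ⊔ IntermediateField.adjoin K ((∅ : Finset Ω) : Set Ω) = L := by
      rw [Finset.coe_empty, IntermediateField.adjoin_empty, sup_bot_eq]
    rw [e]; simp
  | insert y T hy ih =>
    intro L h
    have e : L ⊔ IntermediateField.adjoin K ((insert y T : Finset Ω) : Set Ω) =
        (L ⊔ IntermediateField.adjoin K {y}) ⊔ IntermediateField.adjoin K (T : Set Ω) := by
      rw [Finset.coe_insert, Set.insert_eq, IntermediateField.adjoin_union, sup_assoc]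
    rw [e, Finset.card_insert_of_notMem hy]
    have h1 := ih (L ⊔ IntermediateField.adjoin K {y})
      (fun z hz => le_sup_left (a := L) (h z (Finset.mem_insert_of_mem hz)))
    have h2 := aux_finrank_one d hd L y (h y (Finset.mem_insert_self _ _))
    calc _ ≤ _ := h1
      _ ≤ d ^ T.card * (d * Module.finrank K L) := Nat.mul_le_mul_left _ h2
      _ = _ := by ring

/-- The set of `n`-th preimages. -/
noncomputable def aux_F [DecidableEq Ω] (d : ℕ) (c β : Ω) : ℕ → Finset Ω
  | 0 => {β}
  | n + 1 => (aux_F d c β n).biUnion (fun α => (nthRoots d (α - c)).toFinset)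

theorem aux_mem_succ [DecidableEq Ω] (d : ℕ) (hd : 0 < d) (c β : Ω) (n : ℕ) (y : Ω) :
    y ∈ aux_F d c β (n + 1) ↔ y ^ d + c ∈ aux_F d c β n := by
  simp only [aux_F, Finset.mem_biUnion, Multiset.mem_toFinset, mem_nthRoots hd]
  constructor
  · rintro ⟨a, ha, h⟩
    rw [h]; simpa using ha
  · intro h
    exact ⟨_, h, by ring⟩

theorem aux_mem [DecidableEq Ω] (d : ℕ) (hd : 0 < d) (c β : Ω) (n : ℕ) (y : Ω) :
    y ∈ aux_F d c β n ↔ (fun x => x ^ d + c)^[n] y = β := by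
  induction n generalizing y with
  | zero => simp [aux_F]
  | succ n ih => rw [aux_mem_succ d hd, ih, Function.iterate_succ_apply]

theorem aux_card_root [DecidableEq Ω] (d : ℕ) (a : Ω) : (nthRoots d a).toFinset.card ≤ d :=
  (Multiset.toFinset_card_le _).trans (card_nthRoots d a)

theorem aux_card_succ [DecidableEq Ω] (d : ℕ) (c β : Ω) (n : ℕ) :
    (aux_F d c β (n + 1)).card ≤ (aux_F d c β n).card * d :=
  Finset.card_biUnion_le_card_mul _ _ _ (fun _ _ => aux_card_root d _)

theorem aux_card [DecidableEq Ω] (d : ℕ) (c β : Ω) (n : ℕ) :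
    (aux_F d c β n).card ≤ d ^ n := by
  induction n with
  | zero => simp [aux_F]
  | succ n ih =>
    rw [pow_succ]
    exact (aux_card_succ d c β n).trans (Nat.mul_le_mul_right _ ih)

theorem aux_card_lt [DecidableEq Ω] (d : ℕ) (hd : 2 ≤ d) (c β : Ω) (m : ℕ)
    (h0 : (0 : Ω) ∈ aux_F d c β (m + 1)) (k : ℕ) :
    (aux_F d c β (m + 1 + k)).card < d ^ (m + 1 + k) := by
  induction k with
  | zero =>
    have hd0 : 0 < d := by omega
    have hc : c ∈ aux_F d c β m := by
      have := (aux_mem_succ d hd0 c β m 0).1 h0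
      simpa [hd0.ne'] using this
    have h1 : (aux_F d c β (m + 1)).card < (aux_F d c β m).card * d := by
      simp only [aux_F]
      refine Finset.card_biUnion_le.trans_lt ?_
      rw [← smul_eq_mul, ← Finset.sum_const]
      refine Finset.sum_lt_sum (fun _ _ => aux_card_root d _) ⟨c, hc, ?_⟩
      have : (nthRoots d (c - c)).toFinset ⊆ {0} := by
        intro x hx
        rw [Multiset.mem_toFinset, mem_nthRoots hd0, sub_self] at hx
        simpa using eq_zero_of_pow_eq_zero hx
      have := Finset.card_le_card this
      rw [Finset.card_singleton] at this
      omega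
    refine h1.trans_le ?_
    rw [Nat.add_zero, pow_succ]
    exact Nat.mul_le_mul_right _ (aux_card d c β m)
  | succ k ih =>
    rw [← Nat.add_assoc, pow_succ]
    exact (aux_card_succ d c β _).trans_lt (Nat.mul_lt_mul_of_pos_right ih (by omega))

theorem aux_aeval {A : Type*} [CommRing A] [Algebra K A] (d : ℕ) (c : K) (n : ℕ) (y : A) :
    Polynomial.aeval y (polyIter (X ^ d + C c : K[X]) n) =
      (fun x => x ^ d + algebraMap K A c)^[n] y := by
  induction n with
  | zero => simp [polyIter]
  | succ n ih =>
    rw [Function.iterate_succ_apply', ← ih]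
    simp [polyIter, aeval_comp]

theorem aux_field [DecidableEq Ω] (d : ℕ) (hd : 0 < d) (c β : K) (n : ℕ) :
    preimField K Ω (X ^ d + C c) β n = IntermediateField.adjoin K
      (aux_F d (algebraMap K Ω c) (algebraMap K Ω β) n : Set Ω) := by
  unfold preimField
  congr 1
  ext y
  simp only [Set.mem_setOf_eq, Finset.mem_coe]
  rw [aux_aeval, aux_mem d hd]

theorem aux_main [DecidableEq Ω] [IsAlgClosure K Ω] (d : ℕ) (hd : 2 ≤ d) (c β : K)
    (ζ : K) (hζ : IsPrimitiveRoot ζ d) (n : ℕ) (R : Finset Ω)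
    (hRF : R ⊆ aux_F d (algebraMap K Ω c) (algebraMap K Ω β) n)
    (hcard : R.card < d ^ n)
    (hR : ∀ α ∈ aux_F d (algebraMap K Ω c) (algebraMap K Ω β) n, α ∈ R ∨
      ∃ z : K, algebraMap K Ω (z ^ d + c) = α) :
    Module.finrank K (preimField K Ω (X ^ d + C c) β (n + 1)) <
      d ^ (d ^ n) * Module.finrank K (preimField K Ω (X ^ d + C c) β n) := by
  have hd0 : 0 < d := by omega
  have : NeZero d := ⟨hd0.ne'⟩
  have hac : IsAlgClosed Ω := IsAlgClosure.isAlgClosed K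
  have halg : Algebra.IsAlgebraic K Ω := IsAlgClosure.isAlgebraic
  rw [aux_field d hd0, aux_field d hd0]
  set c' := algebraMap K Ω c with hc'
  set β' := algebraMap K Ω β with hβ'
  choose r hr using fun a : Ω => IsAlgClosed.exists_pow_nat_eq (a - c') hd0
  set L := IntermediateField.adjoin K (aux_F d c' β' n : Set Ω) with hL
  have hζ' : IsPrimitiveRoot (algebraMap K Ω ζ) d :=
    hζ.map_of_injective (algebraMap K Ω).injective
  have key : ∀ (M : IntermediateField K Ω) (y z : Ω), z ∈ M → y ^ d = z ^ d → y ∈ M := by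
    intro M y z hz h
    by_cases hz0 : z = 0
    · subst hz0
      rw [zero_pow hd0.ne'] at h
      rw [eq_zero_of_pow_eq_zero h]; exact zero_mem M
    · have h1 : (y / z) ^ d = 1 := by
        rw [div_pow, h, div_self (pow_ne_zero _ hz0)]
      obtain ⟨i, _, hi⟩ := hζ'.eq_pow_of_pow_eq_one h1
      have : y = (algebraMap K Ω ζ) ^ i * z := by rw [hi]; field_simp
      rw [this]
      exact mul_mem (pow_mem (M.algebraMap_mem ζ) i) hz
  have hle : IntermediateField.adjoin K (aux_F d c' β' (n + 1) : Set Ω) ≤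
      L ⊔ IntermediateField.adjoin K ((R.image r : Finset Ω) : Set Ω) := by
    rw [IntermediateField.adjoin_le_iff]
    intro y hy
    have hy' := (aux_mem_succ d hd0 c' β' n y).1 hy
    rcases hR _ hy' with h | ⟨z, hz⟩
    · refine key _ y (r (y ^ d + c')) ?_ (by rw [hr]; ring)
      exact le_sup_right (a := L) (IntermediateField.subset_adjoin K _
        (Finset.mem_coe.2 (Finset.mem_image_of_mem r h)))
    · refine key _ y (algebraMap K Ω z) (IntermediateField.algebraMap_mem _ _) ?_
      rw [map_add, map_pow] at hz
      exact (add_right_cancel hz).symm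
  have fin1 : FiniteDimensional K L :=
    IntermediateField.finiteDimensional_adjoin fun x _ => (halg.isAlgebraic x).isIntegral
  have fin2 : FiniteDimensional K
      (IntermediateField.adjoin K ((R.image r : Finset Ω) : Set Ω)) :=
    IntermediateField.finiteDimensional_adjoin fun x _ => (halg.isAlgebraic x).isIntegral
  have h1 := IntermediateField.finrank_le_of_le_right hle
  have h2 := aux_finrank d hd0 (R.image r) L (by
    intro y hy
    obtain ⟨a, ha, rfl⟩ := Finset.mem_image.1 hy
    rw [hr]
    exact sub_mem (IntermediateField.subset_adjoin K _ (Finset.mem_coe.2 (hRF ha)))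
      (L.algebraMap_mem c))
  refine (h1.trans h2).trans_lt ?_
  refine Nat.mul_lt_mul_of_pos_right ?_ Module.finrank_pos
  exact Nat.pow_lt_pow_right (by omega) (Finset.card_image_le.trans_lt hcard)

end helpers

/-- if `β` is periodic or postcritical for `f = X^d + c`, then for infinitely
many `n` the degree `[K_n(β) : K_{n-1}(β)]` is strictly less than `d^(d^(n-1))`. -/
theorem stmt_4 (d : ℕ) (hd : 2 ≤ d)
    (K : Type*) [Field K] [Algebra (RatFunc (AlgebraicClosure ℚ)) K]
    [FunctionField (AlgebraicClosure ℚ) K]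
    (Ω : Type*) [Field Ω] [Algebra K Ω] [IsAlgClosure K Ω]
    (c : K) (f : K[X]) (hf : f = X ^ d + C c) (β : K)
    (hβ : (∃ n : ℕ, 1 ≤ n ∧ (polyIter f n).eval β = β) ∨
      (∃ n : ℕ, 1 ≤ n ∧ (polyIter f n).eval 0 = β)) :
    {n : ℕ | 1 ≤ n ∧
      Module.finrank K (preimField K Ω f β n) <
        d ^ (d ^ (n - 1)) * Module.finrank K (preimField K Ω f β (n - 1))}.Infinite := by
  classical
  subst hf
  have hd0 : 0 < d := by omega
  have : NeZero d := ⟨hd0.ne'⟩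
  obtain ⟨ζ₀, hζ₀⟩ := HasEnoughRootsOfUnity.exists_primitiveRoot (AlgebraicClosure ℚ) d
  let φ : AlgebraicClosure ℚ →+* K :=
    (algebraMap (RatFunc (AlgebraicClosure ℚ)) K).comp RatFunc.C
  have hζ : IsPrimitiveRoot (φ ζ₀) d := hζ₀.map_of_injective φ.injective
  have hev : ∀ (n : ℕ) (y : K), (polyIter (X ^ d + C c : K[X]) n).eval y =
      (fun x => x ^ d + c)^[n] y := by
    intro n y
    have := aux_aeval (K := K) (A := K) d c n y
    simpa using this
  have hsemi : ∀ (n : ℕ) (y : K), algebraMap K Ω ((fun x => x ^ d + c)^[n] y) =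
      (fun x => x ^ d + algebraMap K Ω c)^[n] (algebraMap K Ω y) := by
    intro n y
    have : Function.Semiconj (algebraMap K Ω) (fun x => x ^ d + c)
        (fun x => x ^ d + algebraMap K Ω c) := fun x => by simp
    exact (this.iterate_right n) y
  suffices h : ∃ N : ℕ, ∀ n, N ≤ n →
      Module.finrank K (preimField K Ω (X ^ d + C c) β (n + 1)) <
      d ^ (d ^ n) * Module.finrank K (preimField K Ω (X ^ d + C c) β n) by
    obtain ⟨N, hN⟩ := h
    refine Set.infinite_of_forall_exists_gt fun a => ⟨max a N + 1, ⟨by omega, ?_⟩, by omega⟩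
    exact hN _ (le_max_right _ _)
  rcases hβ with ⟨m, hm, h⟩ | ⟨m, hm, h⟩
  · refine ⟨0, fun n _ => ?_⟩
    rw [hev] at h
    obtain ⟨m, rfl⟩ : ∃ k, m = k + 1 := ⟨m - 1, by omega⟩
    set g : K → K := fun x => x ^ d + c with hg
    have hγ : ∀ n, g^[n] (g^[m * n] β) = β := by
      intro n
      rw [← Function.iterate_add_apply, show n + m * n = (m + 1) * n by ring]
      exact (Function.IsPeriodicPt.mul_const (f := g) h n)
    have hγ' : g (g^[m * (n + 1)] β) = g^[m * n] β := by
      rw [← Function.iterate_succ_apply' g, show (m * (n + 1)).succ = m * n + (m + 1) by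
        rw [Nat.succ_eq_add_one]; ring, Function.iterate_add_apply, h]
    have hmem : algebraMap K Ω (g^[m * n] β) ∈
        aux_F d (algebraMap K Ω c) (algebraMap K Ω β) n := by
      rw [aux_mem d hd0, ← hsemi, hγ]
    refine aux_main d hd c β _ hζ n
      ((aux_F d (algebraMap K Ω c) (algebraMap K Ω β) n).erase (algebraMap K Ω (g^[m * n] β)))
      (Finset.erase_subset _ _) ?_ ?_
    · exact (Finset.card_erase_lt_of_mem hmem).trans_le (aux_card _ _ _ _)
    · intro α hα
      by_cases he : α = algebraMap K Ω (g^[m * n] β)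
      · right
        exact ⟨g^[m * (n + 1)] β, by rw [he, ← hγ']⟩
      · left
        exact Finset.mem_erase.2 ⟨he, hα⟩
  · obtain ⟨m, rfl⟩ : ∃ k, m = k + 1 := ⟨m - 1, by omega⟩
    refine ⟨m + 1, fun n hn => ?_⟩
    obtain ⟨k, rfl⟩ := Nat.exists_eq_add_of_le hn
    rw [hev] at h
    refine aux_main d hd c β _ hζ (m + 1 + k) _ (Finset.Subset.refl _) ?_
      (fun α hα => Or.inl hα)
    apply aux_card_lt d hd
    rw [aux_mem d hd0, ← map_zero (algebraMap K Ω), ← hsemi, h]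
end

section
/- Let F be a field of characteristic 0, let d ≥ 2 be an integer, c ∈ F, f = X^d + C c ∈ F[X], and β ∈ F. Suppose there exists m ≥ 1 with f^m(0) = β. Then for every n ≥ m, the number of distinct roots of f^n(X) − β in an algebraic closure of F is at most (d^m − 1)·d^(n−m). -/
open Polynomial

lemma aeval_polyIter {F Ω : Type*} [Field F] [Field Ω] [Algebra F Ω] (d : ℕ) (c : F) (n : ℕ) (x : Ω) :
    aeval x (polyIter (X ^ d + C c : F[X]) n) = (fun y : Ω => y ^ d + algebraMap F Ω c)^[n] x := by
  induction n with
  | zero => simp [polyIter]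
  | succ n ih =>
    rw [Function.iterate_succ_apply', ← ih, polyIter, aeval_comp]
    simp

lemma cover_preimage {Ω : Type*} [Field Ω] (d : ℕ) (hd : 0 < d) (c : Ω) (T : Finset Ω) :
    ∃ T' : Finset Ω, T'.card ≤ T.card * d ∧ ∀ x : Ω, x ^ d + c ∈ T → x ∈ T' := by
  classical
  refine ⟨T.biUnion (fun b => (nthRoots d (b - c)).toFinset), ?_, ?_⟩
  · exact Finset.card_biUnion_le_card_mul _ _ _ (fun b _ =>
      (Multiset.toFinset_card_le _).trans (card_nthRoots _ _))
  · intro x hx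
    refine Finset.mem_biUnion.2 ⟨_, hx, ?_⟩
    simp [mem_nthRoots hd]

lemma cover_step {Ω : Type*} [Field Ω] (d : ℕ) (hd : 0 < d) (c b : Ω) (k N : ℕ)
    (h : ∃ T : Finset Ω, T.card ≤ N ∧ ∀ x : Ω, (fun y : Ω => y ^ d + c)^[k] x = b → x ∈ T) (j : ℕ) :
    ∃ T : Finset Ω, T.card ≤ N * d ^ j ∧
      ∀ x : Ω, (fun y : Ω => y ^ d + c)^[k + j] x = b → x ∈ T := by
  induction j with
  | zero => simpa using h
  | succ j ih =>
    obtain ⟨T, hT, hx⟩ := ih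
    obtain ⟨T', hT', hx'⟩ := cover_preimage d hd c T
    refine ⟨T', hT'.trans ?_, fun x h => hx' x (hx _ ?_)⟩
    · rw [pow_succ, ← mul_assoc]
      exact Nat.mul_le_mul_right _ hT
    · rw [← add_assoc, Function.iterate_succ_apply] at h
      exact h

lemma cover_base {Ω : Type*} [Field Ω] (d : ℕ) (hd : 2 ≤ d) (c b : Ω) (k : ℕ)
    (hb : (fun y : Ω => y ^ d + c)^[k + 1] 0 = b) :
    ∃ T : Finset Ω, T.card ≤ d ^ (k + 1) - 1 ∧
      ∀ x : Ω, (fun y : Ω => y ^ d + c)^[k + 1] x = b → x ∈ T := by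
  classical
  obtain ⟨T, hT, hx⟩ := cover_step d (by omega) c b 0 1 ⟨{b}, by simp, by simp⟩ k
  rw [zero_add] at hx
  rw [one_mul] at hT
  have hc : c ∈ T := by
    apply hx
    rw [Function.iterate_succ_apply] at hb
    simpa [show d ≠ 0 by omega] using hb
  obtain ⟨T', hT', hx'⟩ := cover_preimage d (by omega) c (T.erase c)
  refine ⟨insert 0 T', (Finset.card_insert_le _ _).trans ?_, ?_⟩
  · rw [Finset.card_erase_of_mem hc] at hT'
    have h1 : 1 ≤ T.card := Finset.card_pos.2 ⟨c, hc⟩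
    obtain ⟨t, ht⟩ := Nat.exists_eq_add_of_le h1
    rw [ht, Nat.add_sub_cancel_left] at hT'
    have h2 : (1 + t) * d ≤ d ^ (k + 1) := by
      rw [pow_succ, ← ht]
      exact Nat.mul_le_mul_right _ hT
    rw [add_mul, one_mul] at h2
    omega
  · intro x h
    rw [Function.iterate_succ_apply] at h
    by_cases h0 : x = 0
    · simp [h0]
    · refine Finset.mem_insert_of_mem (hx' x (Finset.mem_erase.2 ⟨?_, hx _ h⟩))
      simp [h0]

/-- if `β = f^m(0)` for some `m ≥ 1`, then for all `n ≥ m` the polynomial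
`f^n(X) - β` has at most `(d^m - 1) * d^(n-m)` distinct roots in an algebraic closure. -/
theorem stmt_5 (F : Type*) [Field F] [CharZero F]
    (Ω : Type*) [Field Ω] [Algebra F Ω] [IsAlgClosure F Ω]
    (d : ℕ) (hd : 2 ≤ d) (c : F) (f : F[X]) (hf : f = X ^ d + C c) (β : F)
    (m : ℕ) (hm : 1 ≤ m) (hβ : (polyIter f m).eval 0 = β) :
    ∀ n : ℕ, m ≤ n →
      ((polyIter f n - C β).rootSet Ω).ncard ≤ (d ^ m - 1) * d ^ (n - m) := by
  intro n hn
  subst hf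
  obtain ⟨k, rfl⟩ := Nat.exists_eq_add_of_le' hm
  obtain ⟨j, rfl⟩ := Nat.exists_eq_add_of_le hn
  have hb : (fun y : Ω => y ^ d + algebraMap F Ω c)^[k + 1] 0 = algebraMap F Ω β := by
    rw [← aeval_polyIter, ← hβ, ← map_zero (algebraMap F Ω), aeval_algebraMap_apply]
    simp
  obtain ⟨T, hT, hx⟩ := cover_step d (by omega) _ _ _ _ (cover_base d hd _ _ k hb) j
  rw [Nat.add_sub_cancel_left]
  refine le_trans ?_ hT
  rw [← Set.ncard_coe_finset]
  refine Set.ncard_le_ncard (fun x h => hx x ?_) T.finite_toSet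
  have h2 := (mem_rootSet.1 h).2
  rw [map_sub, aeval_C, sub_eq_zero, aeval_polyIter] at h2
  exact h2
end

section
/- Let d ≥ 2 and let F be a field of characteristic 0 containing a primitive d-th root of unity. Let c ∈ F, f = X^d + C c ∈ F[X], β ∈ F, and fix an algebraic closure Ω of F. Set F_0 = F and, for n ≥ 1, let F_n be the intermediate field of Ω/F generated over F by all roots in Ω of f^n(X) − β. Then for every n ≥ 1: F_n is a Galois extension of F_{n−1}, and there is an injective group homomorphism from Gal(F_n/F_{n−1}) into the additive group of functions from the root set of f^{n−1}(X) − β in Ω to ZMod d. In particular, Gal(F_n/F_{n−1}) is abelian of exponent dividing d, and [F_n : F_{n−1}] ≤ d^(number of distinct roots of f^{n−1}(X) − β in Ω). -/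
open Polynomial

/-- An extension generated by `d`-th roots is Galois and its group embeds into functions
to `ZMod d`. -/
theorem kummer_aux {K L I : Type*} [Field K] [Field L] [Algebra K L] [CharZero K] (d : ℕ)
    [NeZero d] (ζ : K) (hζ : IsPrimitiveRoot ζ d) (r : I → L)
    (hr : ∀ i, ∃ a : K, r i ^ d = algebraMap K L a)
    (htop : IntermediateField.adjoin K (Set.range r) = ⊤) :
    IsGalois K L ∧ ∃ φ : (L ≃ₐ[K] L) →* Multiplicative (I → ZMod d), Function.Injective φ := by
  have hζL : IsPrimitiveRoot (algebraMap K L ζ) d :=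
    hζ.map_of_injective (algebraMap K L).injective
  have hd0 : d ≠ 0 := NeZero.ne d
  constructor
  · have hint : ∀ x ∈ Set.range r, IsIntegral K x := by
      rintro _ ⟨i, rfl⟩
      obtain ⟨a, ha⟩ := hr i
      exact IsIntegral.of_pow (Nat.pos_of_ne_zero hd0) (ha ▸ isIntegral_algebraMap)
    have hspl : ∀ x ∈ Set.range r,
        IsIntegral K x ∧ ((minpoly K x).map (algebraMap K L)).Splits := by
      intro x hx
      refine ⟨hint x hx, ?_⟩
      obtain ⟨i, rfl⟩ := hx
      obtain ⟨a, ha⟩ := hr i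
      refine (X_pow_sub_C_splits_of_isPrimitiveRoot hζL ha).of_dvd
        (X_pow_sub_C_ne_zero (Nat.pos_of_ne_zero hd0) _) ?_
      have h1 : minpoly K (r i) ∣ X ^ d - C a := minpoly.dvd _ _ (by simp [ha])
      have h2 := Polynomial.map_dvd (algebraMap K L) h1
      simpa using h2
    have halg : Algebra.IsAlgebraic K L := by
      constructor
      intro x
      have hh := IntermediateField.isAlgebraic_adjoin hint
      rw [htop] at hh
      have h3 := hh.isAlgebraic ⟨x, IntermediateField.mem_top⟩
      exact (IntermediateField.isAlgebraic_iff (x := (⟨x, IntermediateField.mem_top⟩ :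
        (⊤ : IntermediateField K L)))).1 h3
    have hn : Normal K L :=
      { splits' := fun x => IntermediateField.splits_of_mem_adjoin K L hspl
          (by rw [htop]; exact IntermediateField.mem_top) }
    exact { }
  · have key : ∀ (σ : L ≃ₐ[K] L) (i : I), ∃ a : ZMod d,
        σ (r i) = algebraMap K L ζ ^ a.val * r i ∧ (r i = 0 → a = 0) := by
      intro σ i
      by_cases h0 : r i = 0
      · exact ⟨0, by simp [h0], fun _ => rfl⟩
      · obtain ⟨a, ha⟩ := hr i
        have h1 : (σ (r i) / r i) ^ d = 1 := by
          rw [div_pow, ← map_pow, ha, AlgEquiv.commutes, ← ha, div_self (pow_ne_zero _ h0)]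
        obtain ⟨j, hj, hj'⟩ := hζL.eq_pow_of_pow_eq_one h1
        refine ⟨(j : ZMod d), ?_, fun h => absurd h h0⟩
        rw [ZMod.val_cast_of_lt hj, hj', div_mul_cancel₀ _ h0]
    choose A hA hA0 using key
    have hmul : ∀ σ τ, A (σ * τ) = A σ + A τ := by
      intro σ τ
      funext i
      by_cases h0 : r i = 0
      · simp [hA0 _ i h0]
      · have h1 := hA (σ * τ) i
        rw [AlgEquiv.mul_apply, hA τ i, map_mul, map_pow, AlgEquiv.commutes, hA σ i,
          ← mul_assoc, ← pow_add] at h1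
        have h2 := mul_right_cancel₀ h0 h1
        rw [(hζL.isOfFinOrder hd0).pow_eq_pow_iff_modEq, ← hζL.eq_orderOf, ← ZMod.natCast_eq_natCast_iff] at h2
        simp at h2
        rw [Pi.add_apply, add_comm, h2]
    refine ⟨MonoidHom.mk' (fun σ => Multiplicative.ofAdd (A σ)) ?_, ?_⟩
    · intro σ τ
      rw [hmul, ofAdd_add]
    · rw [injective_iff_map_eq_one]
      intro σ hσ
      have hσ' : A σ = 0 := hσ
      have h1 : ∀ i, σ (r i) = r i := fun i => by rw [hA, hσ']; simp
      ext x
      have hx : x ∈ IntermediateField.adjoin K (Set.range r) := by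
        rw [htop]; exact IntermediateField.mem_top
      have hle : IntermediateField.adjoin K (Set.range r) ≤
          IntermediateField.fixedField (Subgroup.zpowers σ) := by
        rw [IntermediateField.adjoin_le_iff]
        rintro _ ⟨i, rfl⟩
        rintro ⟨g, hg⟩
        have : Subgroup.zpowers σ ≤ MulAction.stabilizer (L ≃ₐ[K] L) (r i) := by
          rw [Subgroup.zpowers_le]; exact h1 i
        exact this hg
      exact hle hx ⟨σ, Subgroup.mem_zpowers σ⟩

theorem aeval_polyIter_succ {K Ω : Type*} [Field K] [Field Ω] [Algebra K Ω] (f : K[X]) (x : Ω) :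
    ∀ n, aeval x (polyIter f (n + 1)) = aeval (aeval x f) (polyIter f n)
  | 0 => by simp [polyIter, aeval_comp]
  | n + 1 => by
    rw [polyIter, aeval_comp, aeval_polyIter_succ f x n, polyIter, aeval_comp]

theorem natDegree_polyIter {K : Type*} [Field K] (f : K[X]) :
    ∀ n, (polyIter f n).natDegree = f.natDegree ^ n
  | 0 => by simp [polyIter]
  | n + 1 => by rw [polyIter, natDegree_comp, natDegree_polyIter f n, pow_succ']

/-- Kummer structure of consecutive levels of the preimage tower of
`f = X^d + c` over a characteristic-zero field containing a primitive `d`-th root of unity: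
`F_n/F_{n-1}` is Galois, its Galois group embeds in the functions from the root set of
`f^{n-1}(X) - β` to `ZMod d`; in particular it is abelian of exponent dividing `d` and
`[F_n : F_{n-1}] ≤ d^(#roots of f^{n-1}(X) - β)`. -/
theorem stmt_6 (d : ℕ) (hd : 2 ≤ d)
    (F : Type*) [Field F] [CharZero F] (ζ : F) (hζ : IsPrimitiveRoot ζ d)
    (Ω : Type*) [Field Ω] [Algebra F Ω] [IsAlgClosure F Ω]
    (c : F) (f : F[X]) (hf : f = X ^ d + C c) (β : F) :
    ∀ n : ℕ, 1 ≤ n →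
      ∃ hle : preimField F Ω f β (n - 1) ≤ preimField F Ω f β n,
        IsGalois ↥(preimField F Ω f β (n - 1)) ↥(IntermediateField.extendScalars hle) ∧
        (∃ φ : (↥(IntermediateField.extendScalars hle) ≃ₐ[↥(preimField F Ω f β (n - 1))]
              ↥(IntermediateField.extendScalars hle)) →*
              Multiplicative (((polyIter f (n - 1) - C β).rootSet Ω) → ZMod d),
            Function.Injective φ) ∧
        (∀ σ τ : (↥(IntermediateField.extendScalars hle) ≃ₐ[↥(preimField F Ω f β (n - 1))]
            ↥(IntermediateField.extendScalars hle)), σ * τ = τ * σ) ∧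
        (∀ σ : (↥(IntermediateField.extendScalars hle) ≃ₐ[↥(preimField F Ω f β (n - 1))]
            ↥(IntermediateField.extendScalars hle)), σ ^ d = 1) ∧
        Module.finrank ↥(preimField F Ω f β (n - 1)) ↥(IntermediateField.extendScalars hle) ≤
          d ^ ((polyIter f (n - 1) - C β).rootSet Ω).ncard := by
  rintro n hn
  obtain ⟨m, rfl⟩ : ∃ m, n = m + 1 := ⟨n - 1, by omega⟩
  simp only [Nat.add_sub_cancel]
  have : NeZero d := ⟨by omega⟩
  have : IsAlgClosed Ω := IsAlgClosure.isAlgClosed F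
  have hfx : ∀ x : Ω, aeval x f = x ^ d + algebraMap F Ω c := fun x => by simp [hf]
  have hdeg : f.natDegree = d := by rw [hf]; exact natDegree_X_pow_add_C
  have hne : polyIter f m - C β ≠ 0 := by
    intro h
    have h1 : (polyIter f m).natDegree = 0 := by rw [sub_eq_zero.1 h, natDegree_C]
    rw [natDegree_polyIter, hdeg] at h1
    exact absurd h1 (by positivity)
  have hroot : ∀ z : Ω, z ∈ (polyIter f m - C β).rootSet Ω ↔
      aeval z (polyIter f m) = algebraMap F Ω β := by
    intro z
    rw [mem_rootSet]
    simp [hne, sub_eq_zero]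
  have hex : ∀ z : Ω, ∃ w : Ω, w ^ d = z - algebraMap F Ω c := fun z =>
    IsAlgClosed.exists_pow_nat_eq _ (by omega)
  choose R hR using hex
  have hRS : ∀ z : Ω, aeval z (polyIter f m) = algebraMap F Ω β →
      aeval (R z) (polyIter f (m + 1)) = algebraMap F Ω β := by
    intro z hz
    rw [aeval_polyIter_succ, hfx, hR, sub_add_cancel, hz]
  have hRmem : ∀ z : Ω, aeval z (polyIter f m) = algebraMap F Ω β →
      R z ∈ preimField F Ω f β (m + 1) := fun z hz =>
    IntermediateField.subset_adjoin _ _ (hRS z hz)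
  have hle : preimField F Ω f β m ≤ preimField F Ω f β (m + 1) := by
    refine IntermediateField.adjoin_le_iff.2 ?_
    intro z hz
    have h1 : z = R z ^ d + algebraMap F Ω c := by rw [hR, sub_add_cancel]
    rw [h1]
    exact add_mem (pow_mem (hRmem z hz) _) (IntermediateField.algebraMap_mem _ _)
  refine ⟨hle, ?_⟩
  have hζK : IsPrimitiveRoot (algebraMap F (preimField F Ω f β m) ζ) d :=
    hζ.map_of_injective (algebraMap F _).injective
  have hζΩ : IsPrimitiveRoot (algebraMap F Ω ζ) d :=
    hζ.map_of_injective (algebraMap F _).injective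
  let r : (polyIter f m - C β).rootSet Ω → IntermediateField.extendScalars hle :=
    fun z => ⟨R z, hRmem z ((hroot z).1 z.2)⟩
  have hr : ∀ i, ∃ a : preimField F Ω f β m, r i ^ d = algebraMap _ _ a := by
    intro z
    refine ⟨⟨(z : Ω), IntermediateField.subset_adjoin _ _ ((hroot z).1 z.2)⟩ -
      algebraMap F _ c, ?_⟩
    apply Subtype.ext
    exact hR z
  have htop : IntermediateField.adjoin (preimField F Ω f β m) (Set.range r) = ⊤ := by
    apply IntermediateField.lift_injective
    rw [IntermediateField.lift_adjoin, IntermediateField.lift_top]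
    apply le_antisymm
    · rw [IntermediateField.adjoin_le_iff]
      rintro _ ⟨y, -, rfl⟩
      exact y.2
    · refine (le_of_eq (IntermediateField.extendScalars_adjoin hle)).trans ?_
      rw [IntermediateField.adjoin_le_iff]
      intro x hx
      have hx' : aeval x (polyIter f (m + 1)) = algebraMap F Ω β := hx
      rw [aeval_polyIter_succ, ← hroot] at hx'
      have hmem : R (aeval x f) ∈ IntermediateField.adjoin (preimField F Ω f β m)
          (Subtype.val '' Set.range r) :=
        IntermediateField.subset_adjoin _ _ ⟨r ⟨_, hx'⟩, ⟨_, rfl⟩, rfl⟩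
      have hpow : x ^ d = R (aeval x f) ^ d := by rw [hR, hfx, add_sub_cancel_right]
      by_cases h0 : R (aeval x f) = 0
      · rw [h0, zero_pow (NeZero.ne d)] at hpow
        rw [eq_zero_of_pow_eq_zero hpow]
        exact zero_mem _
      · have h1 : (x / R (aeval x f)) ^ d = 1 := by
          rw [div_pow, hpow, div_self (pow_ne_zero _ h0)]
        obtain ⟨j, -, hj⟩ := hζΩ.eq_pow_of_pow_eq_one h1
        have h2 : x = algebraMap F Ω ζ ^ j * R (aeval x f) := by
          rw [hj, div_mul_cancel₀ _ h0]
        have h3 : algebraMap F Ω ζ ∈ IntermediateField.adjoin (preimField F Ω f β m)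
            (Subtype.val '' Set.range r) :=
          IntermediateField.algebraMap_mem _ (algebraMap F (preimField F Ω f β m) ζ)
        have h4 := mul_mem (pow_mem h3 j) hmem
        rw [← h2] at h4
        exact h4
  obtain ⟨hgal, φ, hφ⟩ := kummer_aux d _ hζK r hr htop
  refine ⟨hgal, ⟨φ, hφ⟩, ?_, ?_, ?_⟩
  · intro σ τ
    apply hφ
    rw [map_mul, map_mul, mul_comm]
  · intro σ
    apply hφ
    rw [map_pow, map_one]
    apply Multiplicative.toAdd.injective
    funext i
    simp
  · change Module.finrank (preimField F Ω f β m) (IntermediateField.extendScalars hle) ≤ _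
    by_cases hfd : FiniteDimensional (preimField F Ω f β m) (IntermediateField.extendScalars hle)
    · rw [← IsGalois.card_aut_eq_finrank]
      have : Finite ((polyIter f m - C β).rootSet Ω) := (rootSet_finite _ _).to_subtype
      refine (Nat.card_le_card_of_injective φ hφ).trans (le_of_eq ?_)
      rw [Nat.card_congr Multiplicative.toAdd, Nat.card_fun, Nat.card_zmod, Nat.card_coe_set_eq]
    · rw [Module.finrank_of_not_finite hfd]
      exact Nat.zero_le _
end

section
/- Let L be a number field and let k be a function field of one variable over L (a finite extension of the rational function field L(T)) such that L is algebraically closed in k: every element of k that is algebraic over L lies in the image of L in k. Let p be a prime, r ≥ 1, q = p^r, let t ∈ k not lie in the image of L, and set f = X^q + C t ∈ k[X]. Then for any β ∈ k that is not periodic for f, the pair (f, β) is eventually stable over k: there exists a constant C such that for every n ≥ 1 the number of irreducible factors of f^n(X) − β in k[X], counted with multiplicity, is at most C. -/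
open Polynomial

lemma exists_tau (p : ℕ) [Fact p.Prime] : ∃ τ : ℚ_[p], ‖τ‖ ≤ 1 ∧ Transcendental ℚ τ := by
  have h : ∃ τ : ℚ_[p], Transcendental ℚ τ := by
    by_contra! h
    have h1 := Algebraic.countable ℚ ℚ_[p]
    have h2 : {x : ℚ_[p] | IsAlgebraic ℚ x} = Set.univ := by
      ext x; simpa [Transcendental] using h x
    rw [h2] at h1
    have h3 := continuum_le_cardinal_of_nontriviallyNormedField ℚ_[p]
    have h4 : Cardinal.mk ℚ_[p] ≤ Cardinal.aleph0 := by
      have := h1.le_aleph0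
      simpa using this
    exact absurd (h3.trans h4) (not_le.mpr Cardinal.aleph0_lt_continuum)
  obtain ⟨τ, hτ⟩ := h
  rcases le_total ‖τ‖ 1 with h | h
  · exact ⟨τ, h, hτ⟩
  · refine ⟨τ⁻¹, ?_, ?_⟩
    · rw [norm_inv]; exact inv_le_one_of_one_le₀ h
    · intro ha; exact hτ (by simpa using ha.inv)

lemma trdeg_le (L : Type*) [Field L] [NumberField L]
    (k : Type*) [Field k] [Algebra (RatFunc L) k] [FunctionField L k]
    [Algebra L k] [IsScalarTower L (RatFunc L) k] [CharZero k] : Algebra.trdeg ℚ k ≤ 1 := by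
  have h1 : Algebra.trdeg L (RatFunc L) = 1 := by
    rw [← trdeg_add_eq L L[X] (A := RatFunc L)]
    rw [Polynomial.trdeg_of_isDomain]
    have : Algebra.IsAlgebraic L[X] (RatFunc L) := IsLocalization.isAlgebraic (R := L[X]) (S := RatFunc L) (nonZeroDivisors L[X])
    rw [trdeg_eq_zero]; simp
  have h2 := lift_trdeg_add_eq L (RatFunc L) k
  have : Algebra.IsAlgebraic (RatFunc L) k := inferInstance
  rw [h1, trdeg_eq_zero] at h2
  have h3 := lift_trdeg_add_eq ℚ L k
  rw [trdeg_eq_zero] at h3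
  simp at h2 h3
  rw [← h3, ← h2]

lemma embed (L : Type*) [Field L] [NumberField L]
    (k : Type*) [Field k] [Algebra (RatFunc L) k] [FunctionField L k]
    [Algebra L k] [IsScalarTower L (RatFunc L) k] (p : ℕ) [Fact p.Prime]
    (t : k) (ht : Transcendental L t) : ∃ σ : k →+* PadicAlgCl p, ‖σ t‖ ≤ 1 ∧
      ∃ K : IntermediateField ℚ_[p] (PadicAlgCl p), FiniteDimensional ℚ_[p] K ∧ ∀ y, σ y ∈ K := by
  have : CharZero k := charZero_of_injective_algebraMap (algebraMap L k).injective
  have htQ : Transcendental ℚ t := fun h => ht (h.extendScalars (algebraMap ℚ L).injective)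
  have hb : IsTranscendenceBasis ℚ (fun _ : Unit => t) := by
    apply AlgebraicIndependent.isTranscendenceBasis_of_lift_trdeg_le_of_finite
    · rw [algebraicIndependent_unique_type_iff]; exact htQ
    · simpa using trdeg_le L k
  have halg := hb.isAlgebraic
  obtain ⟨τ, hτ1, hτ⟩ := exists_tau p
  let a1 : Algebra ℚ[X] k := (aeval (R := ℚ) t).toRingHom.toAlgebra
  let a2 : Algebra ℚ[X] (PadicAlgCl p) := (aeval (R := ℚ) (algebraMap ℚ_[p] (PadicAlgCl p) τ)).toRingHom.toAlgebra
  have i1 : Function.Injective (algebraMap ℚ[X] k) := transcendental_iff_injective.1 htQ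
  have i2 : Function.Injective (algebraMap ℚ[X] (PadicAlgCl p)) := by
    apply transcendental_iff_injective.1
    rwa [transcendental_algebraMap_iff (algebraMap ℚ_[p] (PadicAlgCl p)).injective]
  have alg : Algebra.IsAlgebraic ℚ[X] k := by
    have hmem : ∀ P : ℚ[X], aeval t P ∈ Algebra.adjoin ℚ (Set.range fun _ : Unit => t) := by
      intro P
      rw [Set.range_const, Algebra.adjoin_singleton_eq_range_aeval]
      exact ⟨P, rfl⟩
    let φ := (aeval (R := ℚ) t).codRestrict _ hmem
    refine Algebra.IsAlgebraic.of_ringHom_of_comp_eq φ (RingHom.id k) ?_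
      Function.injective_id ?_
    · rintro ⟨y, hy⟩
      have hy' := hy
      rw [Set.range_const, Algebra.adjoin_singleton_eq_range_aeval] at hy'
      obtain ⟨P, hP⟩ := hy'
      exact ⟨P, Subtype.ext hP⟩
    · ext <;> rfl
  have tf1 : FaithfulSMul ℚ[X] k := (faithfulSMul_iff_algebraMap_injective _ _).2 i1
  have tf2 : FaithfulSMul ℚ[X] (PadicAlgCl p) := (faithfulSMul_iff_algebraMap_injective _ _).2 i2
  let σ : k →ₐ[ℚ[X]] PadicAlgCl p := IsAlgClosed.lift
  refine ⟨σ, ?_, ?_⟩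
  · have h1 : t = algebraMap ℚ[X] k X := by
      change _ = aeval t X; simp
    have h2 : algebraMap ℚ[X] (PadicAlgCl p) X = algebraMap ℚ_[p] (PadicAlgCl p) τ := by
      change aeval _ X = _; simp
    rw [h1]
    simp only [RingHom.coe_coe, AlgHom.commutes]
    rw [h2]; simpa using hτ1
  · let bL := Module.finBasis ℚ L
    let bk := Module.finBasis (RatFunc L) k
    let S : Set (PadicAlgCl p) := Set.range (fun i => σ (algebraMap L k (bL i))) ∪
      Set.range (fun i => σ (bk i)) ∪ {σ (algebraMap (RatFunc L) k RatFunc.X)}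
    have hS : S.Finite := ((Set.finite_range _).union (Set.finite_range _)).union (Set.finite_singleton _)
    let K := IntermediateField.adjoin ℚ_[p] S
    refine ⟨K, ?_, ?_⟩
    · have : Finite S := hS
      apply IntermediateField.finiteDimensional_adjoin
      intro x _
      exact Algebra.IsIntegral.isIntegral x
    have hSK : S ⊆ K := IntermediateField.subset_adjoin _ _
    have hL : ∀ y : L, σ (algebraMap L k y) ∈ K := by
      intro y
      rw [← bL.sum_repr y]
      simp only [map_sum, Algebra.smul_def, map_mul]
      refine sum_mem fun i _ => mul_mem ?_ (hSK (Or.inl (Or.inl ⟨i, rfl⟩)))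
      simp
    have hLX : ∀ P : L[X], σ (algebraMap (RatFunc L) k (algebraMap L[X] (RatFunc L) P)) ∈ K := by
      intro P
      induction P using Polynomial.induction_on' with
      | add a b ha hb => simp only [map_add]; exact add_mem ha hb
      | monomial n a =>
        rw [← C_mul_X_pow_eq_monomial]
        simp only [map_mul, map_pow]
        refine mul_mem ?_ (pow_mem (hSK (Or.inr ?_)) _)
        · have := hL a
          rw [IsScalarTower.algebraMap_apply L (RatFunc L) k] at this
          simpa using this
        · simp
    have hR : ∀ y : RatFunc L, σ (algebraMap (RatFunc L) k y) ∈ K := by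
      intro y
      obtain ⟨a, b, _, rfl⟩ := IsFractionRing.div_surjective (A := L[X]) y
      simp only [map_div₀]
      exact div_mem (hLX a) (hLX b)
    intro y
    rw [← bk.sum_repr y]
    simp only [map_sum, Algebra.smul_def, map_mul]
    refine sum_mem fun i _ => mul_mem (hR _) (hSK (Or.inl (Or.inr ⟨i, rfl⟩)))

lemma prod_lt_one {Ω : Type*} [Field Ω] (V : Ω →* ℝ) (hV : ∀ x, 0 ≤ V x) (s : Multiset Ω)
    (h : ∀ x ∈ s, V x < 1) (hs : s ≠ 0) : V s.prod < 1 := by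
  induction s using Multiset.induction_on with
  | empty => exact absurd rfl hs
  | cons a s ih =>
    rw [Multiset.prod_cons, map_mul]
    have ha := h a (Multiset.mem_cons_self a s)
    by_cases h0 : s = 0
    · subst h0; simpa using ha
    · have := ih (fun x hx => h x (Multiset.mem_cons_of_mem hx)) h0
      have h1 := hV a
      have h2 := hV s.prod
      nlinarith

lemma prod_le_pow {α : Type*} [CommMonoid α] (w : α → ℝ) (h1 : w 1 = 1)
    (hm : ∀ x y, w (x * y) = w x * w y) (h0 : ∀ x, 0 ≤ w x) (ρ : ℝ) (hρ : 0 ≤ ρ)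
    (s : Multiset α) (h : ∀ x ∈ s, w x ≤ ρ) : w s.prod ≤ ρ ^ s.card := by
  induction s using Multiset.induction_on with
  | empty => simp [h1]
  | cons a s ih =>
    rw [Multiset.prod_cons, hm, Multiset.card_cons, pow_succ']
    exact mul_le_mul (h a (Multiset.mem_cons_self a s))
      (ih (fun x hx => h x (Multiset.mem_cons_of_mem hx))) (h0 _) hρ

lemma core {k Ω : Type*} [Field k] [Field Ω] [IsAlgClosed Ω] (σ : k →+* Ω) (V : Ω →* ℝ)
    (hV : ∀ x, 0 ≤ V x) (ρ : ℝ) (hρ : 0 ≤ ρ) (hd : ∀ y, V (σ y) < 1 → V (σ y) ≤ ρ)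
    (F : k[X]) (hF : F.Monic) (a : k) (hr : ∀ x, eval₂ σ x F = 0 → V (σ a - x) < 1) :
    V (σ (F.eval a)) ≤ ρ ^ (UniqueFactorizationMonoid.factors F).card := by
  let w : k[X] → ℝ := fun P => V (σ (P.eval a / P.leadingCoeff))
  have hw1 : w 1 = 1 := by simp [w]
  have hwm : ∀ x y, w (x * y) = w x * w y := by
    intro x y
    simp only [w, eval_mul, leadingCoeff_mul]
    rw [← map_mul V, ← map_mul σ, div_mul_div_comm]
  have hF0 : F ≠ 0 := hF.ne_zero
  have hle := prod_le_pow w hw1 hwm (fun x => hV _) ρ hρ (UniqueFactorizationMonoid.factors F) ?_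
  · obtain ⟨u, hu⟩ := UniqueFactorizationMonoid.factors_prod hF0
    have h2 : w F = V (σ (F.eval a)) := by simp [w, hF.leadingCoeff]
    have h3 : w (u : k[X]) = 1 := by
      obtain ⟨c, hc, hcu⟩ := Polynomial.isUnit_iff.1 u.isUnit
      simp only [w, ← hcu, eval_C, leadingCoeff_C]
      rw [div_self hc.ne_zero]; simp
    have h4 := congrArg w hu
    rw [hwm, h3, mul_one] at h4
    rw [← h2, ← h4]; exact hle
  · intro P hP
    apply hd
    have hirr := UniqueFactorizationMonoid.irreducible_of_factor P hP
    have hdvd := UniqueFactorizationMonoid.dvd_of_mem_factors hP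
    have hsp : (P.map σ).Splits := IsAlgClosed.splits _
    have hlc : P.leadingCoeff ≠ 0 := leadingCoeff_ne_zero.2 hirr.ne_zero
    have h1 : σ (P.eval a / P.leadingCoeff) =
        (Multiset.map (fun x => σ a - x) (P.map σ).roots).prod := by
      have := hsp.eval_eq_prod_roots (σ a)
      rw [eval_map, eval₂_at_apply, leadingCoeff_map] at this
      rw [map_div₀, this, mul_div_cancel_left₀]
      simpa using hlc
    rw [h1]
    apply prod_lt_one V hV
    · intro y hy
      obtain ⟨x, hx, rfl⟩ := Multiset.mem_map.1 hy
      apply hr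
      obtain ⟨Q, rfl⟩ := hdvd
      have := isRoot_of_mem_roots hx
      rw [IsRoot, eval_map] at this
      rw [eval₂_mul, this, zero_mul]
    · intro h0
      rw [Multiset.map_eq_zero] at h0
      have := hsp.natDegree_eq_card_roots
      rw [h0, natDegree_map] at this
      exact hirr.natDegree_pos.ne' (by simpa using this)

section dyn
variable {Ω : Type*} [NormedField Ω] [IsUltrametricDist Ω]

/-- closed unit ball -/
def ballRing (Ω : Type*) [NormedField Ω] [IsUltrametricDist Ω] : Subring Ω where
  carrier := {x | ‖x‖ ≤ 1}
  zero_mem' := by simp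
  one_mem' := by simp
  add_mem' := fun {a b} ha hb => (IsUltrametricDist.norm_add_le_max a b).trans (max_le ha hb)
  neg_mem' := fun {a} ha => by simpa using ha
  mul_mem' := fun {a b} ha hb => by
    simp only [Set.mem_ofPred_eq, norm_mul] at *
    exact mul_le_one₀ ha (norm_nonneg _) hb

lemma mem_ballRing (x : Ω) : x ∈ ballRing Ω ↔ ‖x‖ ≤ 1 := Iff.rfl

lemma pow_close (p r : ℕ) (hp : p.Prime) (y h : Ω) (hy : ‖y‖ ≤ 1) (hh : ‖h‖ ≤ 1) :
    ‖(y + h) ^ p ^ r - y ^ p ^ r - h ^ p ^ r‖ ≤ ‖(p : Ω)‖ * ‖h‖ := by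
  obtain ⟨s, hs⟩ := exists_add_pow_prime_pow_eq hp (⟨y, hy⟩ : ballRing Ω) (⟨h, hh⟩ : ballRing Ω) r
  have hs' := congrArg (Subring.subtype _) hs
  simp only [map_add, map_mul, map_pow, map_natCast, Subring.coe_subtype] at hs'
  rw [hs']
  have hsn : ‖(s : Ω)‖ ≤ 1 := s.2
  have : y ^ p ^ r + h ^ p ^ r + (p : Ω) * y * h * s - y ^ p ^ r - h ^ p ^ r = (p * h) * (y * s) := by ring
  rw [this, norm_mul, norm_mul, norm_mul]
  exact mul_le_of_le_one_right (by positivity) (mul_le_one₀ hy (norm_nonneg _) hsn)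


lemma F_int (t : Ω) (ht : ‖t‖ ≤ 1) (q : ℕ) (x : Ω) (hx : ‖x‖ ≤ 1) : ‖x ^ q + t‖ ≤ 1 :=
  (ballRing Ω).add_mem ((ballRing Ω).pow_mem hx q) ht

lemma F_int_rev (t : Ω) (ht : ‖t‖ ≤ 1) (q : ℕ) (hq : q ≠ 0) (x : Ω) (hx : ‖x ^ q + t‖ ≤ 1) : ‖x‖ ≤ 1 := by
  have : ‖x ^ q‖ ≤ 1 := by
    have := (ballRing Ω).sub_mem hx ht
    simpa [mem_ballRing] using this
  rw [norm_pow] at this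
  exact (pow_le_one_iff_of_nonneg (norm_nonneg _) hq).1 this

lemma F_rev (p r : ℕ) (hp : p.Prime) (hpn : ‖(p : Ω)‖ < 1) (t : Ω) (x y : Ω) (hx : ‖x‖ ≤ 1) (hy : ‖y‖ ≤ 1)
    (h : ‖(x ^ p ^ r + t) - (y ^ p ^ r + t)‖ < 1) : ‖x - y‖ < 1 := by
  have hxy : ‖x - y‖ ≤ 1 := (ballRing Ω).sub_mem hx hy
  have h1 := pow_close p r hp y (x - y) hy hxy
  rw [add_sub_cancel] at h1
  have h2 : ‖x ^ p ^ r - y ^ p ^ r - (x - y) ^ p ^ r‖ < 1 :=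
    h1.trans_lt (by nlinarith [norm_nonneg (x - y), norm_nonneg (p : Ω)])
  have h3 : (x - y) ^ p ^ r = ((x ^ p ^ r + t) - (y ^ p ^ r + t)) +
    -(x ^ p ^ r - y ^ p ^ r - (x - y) ^ p ^ r) := by ring
  have h4 : ‖(x - y) ^ p ^ r‖ < 1 := by
    rw [h3]
    refine (IsUltrametricDist.norm_add_le_max _ _).trans_lt (max_lt h ?_)
    rwa [norm_neg]
  rw [norm_pow] at h4
  exact (pow_lt_one_iff_of_nonneg (norm_nonneg _) (pow_pos hp.pos r).ne').1 h4

lemma F_contr (p r : ℕ) (hp : p.Prime) (hr : 1 ≤ r) (hpn : ‖(p : Ω)‖ < 1) (t : Ω) (x y : Ω) (hy : ‖y‖ ≤ 1) (hxy : ‖x - y‖ < 1) (hne : x ≠ y) :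
    ‖(x ^ p ^ r + t) - (y ^ p ^ r + t)‖ < ‖x - y‖ := by
  have h1 := pow_close p r hp y (x - y) hy hxy.le
  rw [add_sub_cancel] at h1
  have h0 : 0 < ‖x - y‖ := norm_pos_iff.2 (sub_ne_zero.2 hne)
  have h2 : ‖x ^ p ^ r - y ^ p ^ r - (x - y) ^ p ^ r‖ < ‖x - y‖ :=
    h1.trans_lt (by nlinarith)
  have h3 : (x ^ p ^ r + t) - (y ^ p ^ r + t) = (x ^ p ^ r - y ^ p ^ r - (x - y) ^ p ^ r)
    + (x - y) ^ p ^ r := by ring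
  rw [h3]
  refine (IsUltrametricDist.norm_add_le_max _ _).trans_lt (max_lt h2 ?_)
  rw [norm_pow]
  exact pow_lt_self_of_lt_one₀ h0 hxy (Nat.one_lt_pow (by lia) hp.one_lt)

lemma it_int (t : Ω) (ht : ‖t‖ ≤ 1) (q : ℕ) (n : ℕ) (x : Ω) (hx : ‖x‖ ≤ 1) :
    ‖(fun y => y ^ q + t)^[n] x‖ ≤ 1 := by
  induction n with
  | zero => simpa
  | succ n ih => rw [Function.iterate_succ_apply']; exact F_int t ht q _ ih

lemma it_int_rev (t : Ω) (ht : ‖t‖ ≤ 1) (q : ℕ) (hq : q ≠ 0) (n : ℕ) (x : Ω)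
    (hx : ‖(fun y => y ^ q + t)^[n] x‖ ≤ 1) : ‖x‖ ≤ 1 := by
  induction n with
  | zero => simpa using hx
  | succ n ih => rw [Function.iterate_succ_apply'] at hx; exact ih (F_int_rev t ht q hq _ hx)

lemma it_rev (p r : ℕ) (hp : p.Prime) (hpn : ‖(p : Ω)‖ < 1) (t : Ω) (ht : ‖t‖ ≤ 1) (n : ℕ) (x y : Ω) (hx : ‖x‖ ≤ 1) (hy : ‖y‖ ≤ 1)
    (h : ‖(fun y => y ^ p ^ r + t)^[n] x - (fun y => y ^ p ^ r + t)^[n] y‖ < 1) : ‖x - y‖ < 1 := by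
  induction n with
  | zero => simpa using h
  | succ n ih =>
    rw [Function.iterate_succ_apply', Function.iterate_succ_apply'] at h
    exact ih (F_rev p r hp hpn t _ _ (it_int t ht _ n x hx) (it_int t ht _ n y hy) h)

lemma it_contr (p r : ℕ) (hp : p.Prime) (hr : 1 ≤ r) (hpn : ‖(p : Ω)‖ < 1) (t : Ω) (ht : ‖t‖ ≤ 1)
    (n : ℕ) (x y : Ω) (_hx : ‖x‖ ≤ 1) (hy : ‖y‖ ≤ 1) (hxy : ‖x - y‖ < 1) (hne : x ≠ y) :
    ‖(fun y => y ^ p ^ r + t)^[n + 1] x - (fun y => y ^ p ^ r + t)^[n + 1] y‖ < ‖x - y‖ := by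
  induction n with
  | zero => simpa using F_contr p r hp hr hpn t x y hy hxy hne
  | succ n ih =>
    rw [Function.iterate_succ_apply', Function.iterate_succ_apply' _ _ y]
    by_cases h : (fun y => y ^ p ^ r + t)^[n + 1] x = (fun y => y ^ p ^ r + t)^[n + 1] y
    · rw [h, sub_self, norm_zero]; exact norm_pos_iff.2 (sub_ne_zero.2 hne)
    · exact (F_contr p r hp hr hpn t _ _ (it_int t ht _ _ y hy) (ih.trans hxy) h).trans ih

lemma it_dist (p r : ℕ) (hp : p.Prime) (hr : 1 ≤ r) (hpn : ‖(p : Ω)‖ < 1) (t : Ω) (ht : ‖t‖ ≤ 1)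
    (m : ℕ) (hm : 1 ≤ m) (b : Ω) (hb : ‖b‖ ≤ 1)
    (hc : ‖(fun y => y ^ p ^ r + t)^[m] b - b‖ < 1)
    (hc0 : (fun y => y ^ p ^ r + t)^[m] b ≠ b) (s : ℕ) (hs : 1 ≤ s) :
    ‖(fun y => y ^ p ^ r + t)^[m * s] b - b‖ = ‖(fun y => y ^ p ^ r + t)^[m] b - b‖ := by
  obtain ⟨m, rfl⟩ := Nat.exists_eq_add_of_le' hm
  induction s, hs using Nat.le_induction with
  | base => simp
  | succ s hs ih =>
    set G := (fun y : Ω => y ^ p ^ r + t) with hG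
    have h0 : 0 < ‖G^[m + 1] b - b‖ := norm_pos_iff.2 (sub_ne_zero.2 hc0)
    have hne : G^[(m + 1) * s] b ≠ b := by
      intro h; rw [h, sub_self, norm_zero] at ih; exact h0.ne ih
    have h1 := it_contr p r hp hr hpn t ht m _ b (it_int t ht _ ((m + 1) * s) b hb) hb (ih ▸ hc) hne
    rw [← hG, ih] at h1
    have h2 : G^[(m + 1) * (s + 1)] b - b =
      (G^[m + 1] (G^[(m + 1) * s] b) - G^[m + 1] b) + (G^[m + 1] b - b) := by
      rw [← Function.iterate_add_apply, mul_add_one, add_comm ((m + 1) * s)]; ring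
    rw [h2, IsUltrametricDist.norm_add_eq_max_of_norm_ne_norm h1.ne]
    exact max_eq_right h1.le

end dyn

lemma K_facts (p : ℕ) [Fact p.Prime] (K : IntermediateField ℚ_[p] (PadicAlgCl p))
    [FiniteDimensional ℚ_[p] K] :
    (∃ ρ : ℝ, 0 ≤ ρ ∧ ρ < 1 ∧ ∀ y ∈ K, ‖y‖ < 1 → ‖y‖ ≤ ρ) ∧
    (∀ u : ℕ → PadicAlgCl p, (∀ n, u n ∈ K) → (∀ n, ‖u n‖ ≤ 1) →
      ∃ i j, i < j ∧ ‖u j - u i‖ < 1) := by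
  let M : Submodule ℚ_[p] (PadicAlgCl p) := K.toSubalgebra.toSubmodule
  have : FiniteDimensional ℚ_[p] M := ‹FiniteDimensional ℚ_[p] K›
  have : ProperSpace M := FiniteDimensional.proper ℚ_[p] M
  constructor
  · have hc : IsCompact (Metric.ball (0 : M) 1) := by
      refine (isCompact_closedBall (0 : M) 1).of_isClosed_subset ?_ Metric.ball_subset_closedBall
      have : (Metric.ball (0 : M) 1) = Subtype.val ⁻¹' (Metric.ball (0 : PadicAlgCl p) 1) := by
        ext x; simp
      rw [this]
      exact (IsUltrametricDist.isClosed_ball _ _).preimage continuous_subtype_val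
    obtain ⟨z, hz, hmax⟩ := hc.exists_isMaxOn ⟨0, by simp⟩ (f := fun x => ‖x‖)
      continuous_norm.continuousOn
    refine ⟨‖z‖, norm_nonneg _, by simpa using hz, fun y hy h => ?_⟩
    have := hmax (a := (⟨y, hy⟩ : M)) (by simpa using h)
    simpa using this
  · intro u hu hu1
    obtain ⟨a, -, φ, hφ, hlim⟩ := (isCompact_closedBall (0 : M) 1).tendsto_subseq
      (x := fun n => (⟨u n, hu n⟩ : M)) (fun n => by simpa using hu1 n)
    obtain ⟨N, hN⟩ := Metric.cauchySeq_iff'.1 hlim.cauchySeq 1 one_pos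
    refine ⟨φ N, φ (N + 1), hφ (Nat.lt_succ_self N), ?_⟩
    have := hN (N + 1) (Nat.le_succ N)
    rw [dist_eq_norm] at this
    simpa using this

lemma eval_iter {k Ω : Type*} [Field k] [Field Ω] (σ : k →+* Ω) (q : ℕ) (t : k) (n : ℕ) (x : Ω) :
    eval₂ σ x (polyIter (X ^ q + C t) n) = (fun y => y ^ q + σ t)^[n] x := by
  induction n with
  | zero => simp [polyIter]
  | succ n ih =>
    rw [Function.iterate_succ_apply', polyIter, eval₂_comp, ih]
    simp

lemma monic_iter {k : Type*} [Field k] (q : ℕ) (hq : q ≠ 0) (t : k) (n : ℕ) :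
    (polyIter (X ^ q + C t) n).Monic ∧ 0 < (polyIter (X ^ q + C t) n).natDegree := by
  induction n with
  | zero => simp [polyIter, monic_X]
  | succ n ih =>
    rw [polyIter]
    constructor
    · exact (monic_X_pow_add_C t hq).comp ih.1 ih.2.ne'
    · rw [natDegree_comp, natDegree_X_pow_add_C]
      exact Nat.mul_pos (Nat.pos_of_ne_zero hq) ih.2

lemma card_bound (ρ A : ℝ) (h0 : 0 ≤ ρ) (h1 : ρ < 1) (hA : 0 < A) :
    ∃ B : ℕ, ∀ c : ℕ, A ≤ ρ ^ c → c ≤ B := by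
  obtain ⟨B, hB⟩ := exists_pow_lt_of_lt_one hA h1
  refine ⟨B, fun c hc => ?_⟩
  by_contra! h
  exact absurd (hc.trans (pow_le_pow_of_le_one h0 h1.le h.le)) (not_le.2 hB)

theorem stmt_9 (L : Type*) [Field L] [NumberField L]
    (k : Type*) [Field k] [Algebra (RatFunc L) k] [FunctionField L k]
    [Algebra L k] [IsScalarTower L (RatFunc L) k]
    (halgclosed : ∀ x : k, IsAlgebraic L x → x ∈ Set.range (algebraMap L k))
    (p r : ℕ) (hp : p.Prime) (hr : 1 ≤ r)
    (t : k) (ht : t ∉ Set.range (algebraMap L k))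
    (f : k[X]) (hf : f = X ^ (p ^ r) + C t)
    (β : k) (hβ : ¬ ∃ n : ℕ, 1 ≤ n ∧ (polyIter f n).eval β = β) :
    ∃ B : ℕ, ∀ n : ℕ, 1 ≤ n →
      (UniqueFactorizationMonoid.factors (polyIter f n - C β)).card ≤ B := by
  have : Fact p.Prime := ⟨hp⟩
  subst hf
  have hq : p ^ r ≠ 0 := (pow_pos hp.pos r).ne'
  obtain ⟨σ, hσt, K, hK, hσK⟩ := embed L k p t (fun h => ht (halgclosed t h))
  obtain ⟨⟨ρ, hρ0, hρ1, hρ⟩, hpig⟩ := K_facts p K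
  have hpn : ‖(p : PadicAlgCl p)‖ < 1 := by
    have h := PadicAlgCl.norm_extends p (p : ℚ_[p])
    rw [map_natCast] at h
    rw [h]; exact Padic.norm_p_lt_one
  set G := (fun y : PadicAlgCl p => y ^ p ^ r + σ t) with hG
  have hGk : ∀ n y, σ ((polyIter (X ^ p ^ r + C t) n).eval y) = G^[n] (σ y) := by
    intro n y
    rw [← eval_iter, eval₂_at_apply]
  have hmonic : ∀ n, (polyIter (X ^ p ^ r + C t) n - C β).Monic := by
    intro n
    obtain ⟨h1, h2⟩ := monic_iter (p ^ r) hq t n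
    refine h1.sub_of_left ?_
    exact degree_C_le.trans_lt (natDegree_pos_iff_degree_pos.1 h2)
  have hroot : ∀ n x, eval₂ σ x (polyIter (X ^ p ^ r + C t) n - C β) = 0 → G^[n] x = σ β := by
    intro n x h
    rw [eval₂_sub, eval_iter, eval₂_C] at h
    exact sub_eq_zero.1 h
  rcases le_or_gt ‖σ β‖ 1 with hb | hb
  · obtain ⟨i, j, hij, hclose⟩ := hpig (fun n => G^[n] (σ β)) (fun n => hGk n β ▸ hσK _)
      (fun n => it_int _ hσt _ n _ hb)
    obtain ⟨m, hm, rfl⟩ : ∃ m, 1 ≤ m ∧ j = i + m := ⟨j - i, by lia, by lia⟩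
    have hc : ‖G^[m] (σ β) - σ β‖ < 1 := by
      refine it_rev p r hp hpn (σ t) hσt i _ _ (it_int _ hσt _ m _ hb) hb ?_
      simpa only [Function.iterate_add_apply] using hclose
    have hc0 : G^[m] (σ β) ≠ σ β := by
      rw [← hGk]
      exact fun h => hβ ⟨m, hm, σ.injective h⟩
    obtain ⟨B, hB⟩ := card_bound ρ ‖G^[m] (σ β) - σ β‖ hρ0 hρ1
      (norm_pos_iff.2 (sub_ne_zero.2 hc0))
    refine ⟨B, fun n hn => hB _ ?_⟩
    have hmn : n + (m * n - n) = m * n := Nat.add_sub_cancel' (Nat.le_mul_of_pos_left n hm)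
    have hdist := it_dist p r hp hr hpn (σ t) hσt m hm (σ β) hb hc hc0 n hn
    have hfa : G^[n] (G^[m * n - n] (σ β)) = G^[m * n] (σ β) := by
      rw [← Function.iterate_add_apply, hmn]
    have key := core σ (normHom (α := PadicAlgCl p)).toMonoidHom (fun x => norm_nonneg x) ρ hρ0
      (fun y => hρ _ (hσK y)) (polyIter (X ^ p ^ r + C t) n - C β) (hmonic n)
      ((polyIter (X ^ p ^ r + C t) (m * n - n)).eval β) ?_
    · refine le_trans (le_of_eq ?_) key
      change _ = ‖σ _‖
      rw [eval_sub, eval_C, map_sub, hGk, hGk, hfa]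
      exact hdist.symm
    · intro x hx
      change ‖_ - x‖ < 1
      have hx' := hroot n x hx
      have hx1 : ‖x‖ ≤ 1 := it_int_rev (σ t) hσt _ hq n x (by rw [← hG, hx']; exact hb)
      rw [hGk]
      refine it_rev p r hp hpn (σ t) hσt n _ _ (it_int _ hσt _ _ _ hb) hx1 ?_
      rw [← hG, hfa, hx', hdist]
      exact hc
  · let V : PadicAlgCl p →* ℝ :=
      (normHom (α := PadicAlgCl p)).toMonoidHom.comp (invMonoidWithZeroHom (G₀ := PadicAlgCl p)).toMonoidHom
    have hV : ∀ x, V x = ‖x⁻¹‖ := fun x => rfl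
    obtain ⟨B, hB⟩ := card_bound ρ ‖(σ β)⁻¹‖ hρ0 hρ1
      (norm_pos_iff.2 (inv_ne_zero (norm_pos_iff.1 (one_pos.trans hb))))
    refine ⟨B, fun n hn => hB _ ?_⟩
    have key := core σ V (fun x => (hV x).symm ▸ norm_nonneg _) ρ hρ0
      (fun y h => by
        rw [hV, ← map_inv₀] at h ⊢
        exact hρ _ (hσK _) h) (polyIter (X ^ p ^ r + C t) n - C β) (hmonic n) 0 ?_
    · refine le_trans (le_of_eq ?_) key
      rw [hV, eval_sub, eval_C, map_sub, hGk, norm_inv, norm_inv]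
      congr 1
      have h1 : ‖G^[n] (σ 0)‖ ≤ 1 := it_int _ hσt _ n _ (by simp)
      rw [sub_eq_add_neg, IsUltrametricDist.norm_add_eq_max_of_norm_ne_norm, norm_neg,
        max_eq_right (h1.trans hb.le)]
      rw [norm_neg]
      exact (h1.trans_lt hb).ne
    · intro x hx
      have hx' := hroot n x hx
      rw [hV, norm_inv, map_zero, zero_sub, norm_neg]
      apply inv_lt_one_of_one_lt₀
      by_contra! h
      have := it_int (σ t) hσt (p ^ r) n x h
      rw [← hG, hx'] at this
      exact absurd hb (not_lt.2 this)
end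

section
/- Let Qbar be the algebraic closure of ℚ, let F = Qbar(T) be the field of rational functions in one variable over Qbar (Mathlib: RatFunc (AlgebraicClosure ℚ)), let q = p^r be a prime power, let c ∈ Qbar, and let f = X^q + C c ∈ F[X] (where c is viewed in F via the constant embedding). Then for every n ≥ 1 the polynomial f^n(X) − T is irreducible in F[X], where T denotes the generator RatFunc.X of F and f^n is the n-th iterate of f under polynomial composition. -/
open Polynomial

theorem polyIter_map_aux {K L : Type*} [CommRing K] [CommRing L] (φ : K →+* L) (g : K[X]) (n : ℕ) :
    polyIter (g.map φ) n = (polyIter g n).map φ := by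
  induction n with
  | zero => simp [polyIter]
  | succ n ih => simp [polyIter, ih, Polynomial.map_comp]

theorem polyIter_monic_aux {K : Type*} [Field K] (q : ℕ) (hq : 1 ≤ q) (c : K) (n : ℕ) :
    (polyIter (X ^ q + C c) n).Monic ∧ 0 < (polyIter (X ^ q + C c) n).natDegree := by
  induction n with
  | zero => simp [polyIter, monic_X]
  | succ n ih =>
    have h1 : (X ^ q + C c : K[X]).Monic := monic_X_pow_add_C c (by omega)
    refine ⟨h1.comp ih.1 ih.2.ne', ?_⟩
    rw [polyIter, natDegree_comp, natDegree_X_pow_add_C]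
    exact Nat.mul_pos hq ih.2

theorem irreducible_aux {K : Type*} [Field K] (g : K[X]) (hg : g.Monic) (hd : 0 < g.natDegree) :
    Irreducible (g.map (RatFunc.C : K →+* RatFunc K) - C RatFunc.X) := by
  have hm : (g.map (C : K →+* K[X]) - C (X : K[X])).Monic := by
    apply (hg.map C).sub_of_left
    refine lt_of_le_of_lt degree_C_le ?_
    rw [degree_map_eq_of_injective C_injective]
    exact natDegree_pos_iff_degree_pos.mp hd
  have hi : Irreducible (g.map (C : K →+* K[X]) - C (X : K[X])) := by
    have h2 : Irreducible (C g - X : K[X][X]) := by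
      rw [← neg_sub]
      exact (Associated.refl _).neg_left.irreducible_iff.mpr (irreducible_X_sub_C g)
    have h3 := (MulEquiv.irreducible_iff (Polynomial.Bivariate.swap (R := K))).mpr h2
    simpa [Polynomial.Bivariate.swap_Y, Polynomial.Bivariate.swap_C] using h3
  have h4 := (hm.irreducible_iff_irreducible_map_fraction_map (K := RatFunc K)).mp hi
  have h5 : (algebraMap K[X] (RatFunc K)).comp C = RatFunc.C := by
    ext x; simp
  simpa [Polynomial.map_map, h5] using h4

/-- for `F = Qbar(T)`, a prime power `q = p^r`, a constant `c ∈ Qbar` and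
`f = X^q + C c ∈ F[X]`, the polynomial `f^n(X) - T` is irreducible over `F` for all `n ≥ 1`. -/
theorem stmt_15 (p r : ℕ) (hp : p.Prime) (hr : 1 ≤ r)
    (c : AlgebraicClosure ℚ)
    (f : (RatFunc (AlgebraicClosure ℚ))[X])
    (hf : f = X ^ (p ^ r) + C (RatFunc.C c)) :
    ∀ n : ℕ, 1 ≤ n → Irreducible (polyIter f n - C RatFunc.X) := by
  intro n _
  have h : f = (X ^ (p ^ r) + C c : (AlgebraicClosure ℚ)[X]).map RatFunc.C := by
    simp [hf]
  obtain ⟨h1, h2⟩ := polyIter_monic_aux (p ^ r) (Nat.pow_pos hp.pos) c n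
  rw [h, polyIter_map_aux]
  exact irreducible_aux _ h1 h2
end

section
/- Let d ≥ 2 be an integer, let K be a function field of one variable over the algebraic closure Qbar of ℚ with fixed algebraic closure Ω, let c ∈ K, f = X^d + C c ∈ K[X], and β ∈ K. Assume f is postcritically finite: there exist integers n > m ≥ 0 with f^n(0) = f^m(0). For n ≥ 0 let K_n(β) be the intermediate field of Ω/K generated over K by all roots in Ω of f^n(X) − β (K_0(β) = K). Then for infinitely many n, the degree [K_n(β) : K_{n−1}(β)] is strictly less than d^(d^(n−1)). -/
open Polynomial

open IntermediateField in
lemma step_le {K Ω : Type*} [Field K] [Field Ω] [Algebra K Ω] (d : ℕ) (hd : 0 < d)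
    (L : IntermediateField K Ω) (x : Ω) (hx : x ^ d ∈ L) :
    Module.finrank K ↥(L ⊔ K⟮x⟯) ≤ d * Module.finrank K L := by
  have h1 : L ⊔ K⟮x⟯ = (adjoin L {x}).restrictScalars K := by
    rw [IntermediateField.restrictScalars_adjoin_eq_sup]
  have h2 : Module.finrank K ↥((adjoin L {x}).restrictScalars K)
      = Module.finrank K L * Module.finrank L (adjoin L {x}) :=
    (Module.finrank_mul_finrank K L (adjoin L {x})).symm
  have hm : (X ^ d - C (⟨x ^ d, hx⟩ : L) : L[X]).Monic := monic_X_pow_sub_C _ hd.ne'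
  have hr : aeval x (X ^ d - C (⟨x ^ d, hx⟩ : L) : L[X]) = 0 := by
    simp [IntermediateField.algebraMap_apply]
  have hi : IsIntegral L x := ⟨_, hm, by simp [IntermediateField.algebraMap_apply]⟩
  have h3 : Module.finrank L (adjoin L {x}) ≤ d := by
    rw [adjoin.finrank hi]
    have := natDegree_le_of_dvd (minpoly.dvd L x hr) hm.ne_zero
    rwa [natDegree_X_pow_sub_C] at this
  rw [h1, h2, mul_comm]
  exact Nat.mul_le_mul_right _ h3

open IntermediateField in
lemma multi_le {K Ω : Type*} [Field K] [Field Ω] [Algebra K Ω] (d : ℕ) (hd : 0 < d)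
    (L : IntermediateField K Ω) (S : Finset Ω) (hS : ∀ x ∈ S, x ^ d ∈ L) :
    Module.finrank K ↥(L ⊔ adjoin K (S : Set Ω)) ≤ d ^ S.card * Module.finrank K L := by
  classical
  induction S using Finset.induction_on with
  | empty =>
    rw [Finset.coe_empty, adjoin_empty, sup_bot_eq, Finset.card_empty, pow_zero, one_mul]
  | insert a S ha ih =>
    have ih' := ih (fun x hx => hS x (Finset.mem_insert_of_mem hx))
    have e : L ⊔ adjoin K ((insert a S : Finset Ω) : Set Ω)
        = (L ⊔ adjoin K (S : Set Ω)) ⊔ K⟮a⟯ := by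
      rw [Finset.coe_insert, Set.insert_eq, adjoin_union, sup_assoc, sup_comm K⟮a⟯]
    rw [e, Finset.card_insert_of_notMem ha]
    refine (step_le d hd _ a ((le_sup_left : L ≤ _) (hS a (Finset.mem_insert_self _ _)))).trans ?_
    rw [pow_succ, mul_comm _ d, mul_assoc]
    exact Nat.mul_le_mul_left _ ih'

lemma root_mem {K Ω : Type*} [Field K] [Field Ω] [Algebra K Ω] (d : ℕ) (hd : 0 < d)
    (ζ : K) (hζ : IsPrimitiveRoot ζ d) (E : IntermediateField K Ω) (x y : Ω) (hy : y ∈ E)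
    (h : x ^ d = y ^ d) : x ∈ E := by
  have : NeZero d := ⟨hd.ne'⟩
  by_cases hy0 : y = 0
  · subst hy0
    rw [zero_pow hd.ne'] at h
    rw [pow_eq_zero_iff hd.ne'] at h
    exact h ▸ hy
  have h1 : (x / y) ^ d = 1 := by rw [div_pow, h, div_self (pow_ne_zero _ hy0)]
  obtain ⟨i, -, hi⟩ := (hζ.map_of_injective (algebraMap K Ω).injective).eq_pow_of_pow_eq_one h1
  have : x = (algebraMap K Ω ζ) ^ i * y := by rw [hi]; field_simp
  rw [this]
  exact E.mul_mem (pow_mem (E.algebraMap_mem ζ) i) hy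

open IntermediateField in
lemma dep_le {K Ω : Type*} [Field K] [Field Ω] [Algebra K Ω] (d : ℕ) (hd : 0 < d)
    (ζ : K) (hζ : IsPrimitiveRoot ζ d)
    (L : IntermediateField K Ω) (T : Finset Ω) (hT : T.Nonempty) (g : Ω → Ω)
    (hg : ∀ a ∈ T, g a ^ d ∈ L) (δ : Ω) (hδ : δ ∈ L) (h : (∏ a ∈ T, g a) ^ d = δ ^ d) :
    Module.finrank K ↥(L ⊔ adjoin K (g '' T)) ≤ d ^ (T.card - 1) * Module.finrank K L := by
  classical
  have key : ∃ a ∈ T, g a ∈ L ⊔ adjoin K (g '' ((T.erase a : Finset Ω) : Set Ω)) := by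
    by_cases h0 : ∃ a ∈ T, g a = 0
    · obtain ⟨a, ha, h0⟩ := h0
      exact ⟨a, ha, h0 ▸ zero_mem _⟩
    · push Not at h0
      obtain ⟨a, ha⟩ := hT
      refine ⟨a, ha, ?_⟩
      set E := L ⊔ adjoin K (g '' ((T.erase a : Finset Ω) : Set Ω)) with hE
      have h1 : ∏ b ∈ T, g b ∈ E := root_mem d hd ζ hζ E _ δ ((le_sup_left : L ≤ E) hδ) h
      have h2 : ∏ b ∈ T.erase a, g b ∈ E := prod_mem fun b hb =>
        (le_sup_right : _ ≤ E) (subset_adjoin K _ ⟨b, hb, rfl⟩)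
      have h3 : ∏ b ∈ T.erase a, g b ≠ 0 :=
        Finset.prod_ne_zero_iff.2 fun b hb => h0 b (Finset.mem_of_mem_erase hb)
      rw [← Finset.mul_prod_erase T g ha] at h1
      have := E.div_mem h1 h2
      rwa [mul_div_cancel_right₀ _ h3] at this
  obtain ⟨a, ha, hga⟩ := key
  have e : L ⊔ adjoin K (g '' T) = L ⊔ adjoin K (((T.erase a).image g : Finset Ω) : Set Ω) := by
    rw [Finset.coe_image]
    apply le_antisymm
    · refine sup_le le_sup_left (adjoin_le_iff.2 ?_)
      rintro _ ⟨b, hb, rfl⟩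
      by_cases hba : b = a
      · subst hba; exact hga
      · exact (le_sup_right : _ ≤ L ⊔ adjoin K (g '' ((T.erase a : Finset Ω) : Set Ω)))
          (subset_adjoin K _ ⟨b, Finset.mem_coe.2 (Finset.mem_erase.2 ⟨hba, hb⟩), rfl⟩)
    · refine sup_le_sup_left (adjoin.mono K _ _ (Set.image_mono ?_)) _
      exact_mod_cast Finset.erase_subset a T
  rw [e]
  refine (multi_le d hd L _ ?_).trans ?_
  · intro x hx
    obtain ⟨b, hb, rfl⟩ := Finset.mem_image.1 hx
    exact hg b (Finset.mem_of_mem_erase hb)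
  · refine Nat.mul_le_mul_right _ (Nat.pow_le_pow_right hd ?_)
    exact Finset.card_image_le.trans (Finset.card_erase_of_mem ha).le

lemma polyIter_succ' {K : Type*} [CommRing K] (f : K[X]) (n : ℕ) :
    polyIter f (n + 1) = (polyIter f n).comp f := by
  induction n with
  | zero => simp [polyIter]
  | succ n ih =>
    have e : polyIter f (n + 1 + 1) = f.comp (polyIter f (n + 1)) := rfl
    have e' : polyIter f (n + 1) = f.comp (polyIter f n) := rfl
    rw [e, ih, ← comp_assoc, ← e', ih]

lemma polyIter_add_eval {K : Type*} [CommRing K] (f : K[X]) (x : K) (n m k : ℕ)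
    (h : (polyIter f n).eval x = (polyIter f m).eval x) :
    (polyIter f (n + k)).eval x = (polyIter f (m + k)).eval x := by
  induction k with
  | zero => exact h
  | succ k ih => rw [← add_assoc, ← add_assoc, polyIter, polyIter, eval_comp, eval_comp, ih]

lemma polyIter_monic {K : Type*} [Field K] (d : ℕ) (hd : 0 < d) (c : K) (n : ℕ) :
    (polyIter (X ^ d + C c) n).Monic ∧ (polyIter (X ^ d + C c) n).natDegree = d ^ n := by
  induction n with
  | zero => simp [polyIter, monic_X]
  | succ n ih =>
    constructor
    · rw [polyIter]
      exact (monic_X_pow_add_C c hd.ne').comp ih.1 (by rw [ih.2]; positivity)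
    · rw [polyIter, natDegree_comp, ih.2, natDegree_X_pow_add_C, pow_succ, mul_comm]

/-- the shifted iterate, over the large field. -/
noncomputable def shiftIter {K : Type*} (Ω : Type*) [Field K] [Field Ω] [Algebra K Ω]
    (f : K[X]) (β : K) (n : ℕ) : Polynomial Ω :=
  (polyIter f n - C β).map (algebraMap K Ω)

lemma shiftIter_monic {K : Type*} (Ω : Type*) [Field K] [Field Ω] [Algebra K Ω]
    (d : ℕ) (hd : 0 < d) (c β : K) (n : ℕ) :
    (shiftIter Ω (X ^ d + C c) β n).Monic ∧
      (shiftIter Ω (X ^ d + C c) β n).natDegree = d ^ n := by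
  obtain ⟨h1, h2⟩ := polyIter_monic d hd c n
  have hlt : degree (C β) < degree (polyIter (X ^ d + C c) n) := by
    refine degree_C_le.trans_lt ?_
    rw [← natDegree_pos_iff_degree_pos, h2]; positivity
  refine ⟨(h1.sub_of_left hlt).map _, ?_⟩
  rw [shiftIter, natDegree_map, natDegree_sub_C, h2]

lemma mem_shiftIter_roots {K : Type*} (Ω : Type*) [Field K] [Field Ω] [Algebra K Ω]
    (d : ℕ) (hd : 0 < d) (c β : K) (n : ℕ) (x : Ω) :
    x ∈ (shiftIter Ω (X ^ d + C c) β n).roots ↔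
      aeval x (polyIter (X ^ d + C c) n) = algebraMap K Ω β := by
  rw [mem_roots (shiftIter_monic Ω d hd c β n).1.ne_zero, IsRoot, shiftIter, eval_map,
    ← aeval_def, map_sub, aeval_C, sub_eq_zero]

lemma shiftIter_prod {K : Type*} (Ω : Type*) [Field K] [Field Ω] [Algebra K Ω] [IsAlgClosed Ω]
    (d : ℕ) (hd : 0 < d) (c β : K) (n : ℕ) :
    ((shiftIter Ω (X ^ d + C c) β n).roots.map (fun a => algebraMap K Ω c - a)).prod =
      algebraMap K Ω ((polyIter (X ^ d + C c) (n + 1)).eval 0 - β) := by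
  rw [← (IsAlgClosed.splits (shiftIter Ω (X ^ d + C c) β n)).eval_eq_prod_roots_of_monic
    (shiftIter_monic Ω d hd c β n).1, polyIter_succ', eval_comp, shiftIter, eval_map_apply]
  simp [hd.ne']

lemma shiftIter_card {K : Type*} (Ω : Type*) [Field K] [Field Ω] [Algebra K Ω] [IsAlgClosed Ω]
    (d : ℕ) (hd : 0 < d) (c β : K) (n : ℕ) :
    (shiftIter Ω (X ^ d + C c) β n).roots.card = d ^ n := by
  rw [← (IsAlgClosed.splits (shiftIter Ω (X ^ d + C c) β n)).natDegree_eq_card_roots,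
    (shiftIter_monic Ω d hd c β n).2]

lemma preim_mem {K Ω : Type*} [Field K] [Field Ω] [Algebra K Ω]
    (f : K[X]) (β : K) (n : ℕ) (x : Ω) (hx : aeval x (polyIter f n) = algebraMap K Ω β) :
    x ∈ preimField K Ω f β n := IntermediateField.subset_adjoin K _ hx

lemma preim_up {K Ω : Type*} [Field K] [Field Ω] [Algebra K Ω] (d : ℕ)
    (c β : K) (n : ℕ) (x : Ω) :
    aeval x (polyIter (X ^ d + C c) (n + 1)) = algebraMap K Ω β ↔
    aeval (x ^ d + algebraMap K Ω c) (polyIter (X ^ d + C c) n) = algebraMap K Ω β := by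
  rw [polyIter_succ', aeval_comp]
  simp

lemma preim_mono {K Ω : Type*} [Field K] [Field Ω] [Algebra K Ω] [IsAlgClosed Ω]
    (d : ℕ) (hd : 0 < d) (c β : K) :
    Monotone (preimField K Ω (X ^ d + C c) β) := by
  refine monotone_nat_of_le_succ fun n => IntermediateField.adjoin_le_iff.2 fun x hx => ?_
  obtain ⟨y, hy⟩ := IsAlgClosed.exists_pow_nat_eq (x - algebraMap K Ω c) hd
  have e : x = y ^ d + algebraMap K Ω c := by rw [hy]; ring
  have : y ∈ preimField K Ω (X ^ d + C c) β (n + 1) :=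
    preim_mem _ _ _ _ ((preim_up d c β n y).2 (e ▸ hx))
  rw [e]
  exact add_mem (pow_mem this d) (IntermediateField.algebraMap_mem _ c)

open IntermediateField in
lemma main_step (d : ℕ) (hd : 2 ≤ d) {K Ω : Type*} [Field K] [Field Ω] [Algebra K Ω]
    [IsAlgClosure K Ω] (ζ : K) (hζ : IsPrimitiveRoot ζ d) (ε : K) (hε : ε ^ d = -1)
    (c β : K) (N M : ℕ) (hMN : M < N)
    (h : (polyIter (X ^ d + C c) (N + 1)).eval 0 = (polyIter (X ^ d + C c) (M + 1)).eval 0) :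
    Module.finrank K (preimField K Ω (X ^ d + C c) β (N + 1)) <
        d ^ (d ^ N) * Module.finrank K (preimField K Ω (X ^ d + C c) β N) := by
  classical
  have hd0 : 0 < d := by omega
  have : IsAlgClosed Ω := IsAlgClosure.isAlgClosed K
  have : Algebra.IsAlgebraic K Ω := IsAlgClosure.isAlgebraic
  choose γ hγ using fun x : Ω => IsAlgClosed.exists_pow_nat_eq (x - algebraMap K Ω c) hd0
  set F : K[X] := X ^ d + C c with hF
  set L := preimField K Ω F β N with hL
  set R := (shiftIter Ω F β N).roots with hR
  have hcard : R.card = d ^ N := shiftIter_card Ω d hd0 c β N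
  have hRm : ∀ x, x ∈ R ↔ aeval x (polyIter F N) = algebraMap K Ω β :=
    mem_shiftIter_roots Ω d hd0 c β N
  set T := R.toFinset with hT
  set g : Ω → Ω := fun x => algebraMap K Ω ε * γ x with hgdef
  have hgd : ∀ x, g x ^ d = algebraMap K Ω c - x := by
    intro x
    rw [hgdef]; simp only
    rw [mul_pow, hγ, ← map_pow, hε]; simp
  have hgL : ∀ a ∈ T, g a ^ d ∈ L := by
    intro a ha
    rw [hgd]
    exact sub_mem (L.algebraMap_mem c) (preim_mem _ _ _ _ ((hRm a).1 (Multiset.mem_toFinset.1 ha)))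
  have hε0 : ε ≠ 0 := by
    rintro rfl
    rw [zero_pow hd0.ne'] at hε
    exact one_ne_zero (neg_eq_zero.1 hε.symm)
  have hgen : preimField K Ω F β (N + 1) ≤ L ⊔ adjoin K (g '' (T : Set Ω)) := by
    refine adjoin_le_iff.2 fun x hx => ?_
    have hx' := (preim_up d c β N x).1 hx
    set a := x ^ d + algebraMap K Ω c with ha
    have haT : a ∈ T := Multiset.mem_toFinset.2 ((hRm a).2 hx')
    set E := L ⊔ adjoin K (g '' (T : Set Ω)) with hE
    have h1 : g a ∈ E := (le_sup_right : _ ≤ E) (subset_adjoin K _ ⟨a, haT, rfl⟩)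
    have h2 : γ a ∈ E := by
      have := E.mul_mem (E.algebraMap_mem ε⁻¹) h1
      rw [hgdef] at this
      simp only at this
      rwa [← mul_assoc, ← map_mul, inv_mul_cancel₀ hε0, map_one, one_mul] at this
    refine root_mem d hd0 ζ hζ E x (γ a) h2 ?_
    rw [hγ, ha]; ring
  have hTpos : T.Nonempty := by
    have : R ≠ 0 := by
      intro h0
      rw [h0, Multiset.card_zero] at hcard
      exact (pow_pos hd0 N).ne hcard
    obtain ⟨a, ha⟩ := Multiset.exists_mem_of_ne_zero this
    exact ⟨a, Multiset.mem_toFinset.2 ha⟩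
  have hfinL : FiniteDimensional K L := by
    have : Finite {x : Ω | aeval x (polyIter F N) = algebraMap K Ω β} :=
      (T.finite_toSet.subset fun x hx => Multiset.mem_toFinset.2 ((hRm x).2 hx)).to_subtype
    exact finiteDimensional_adjoin fun x _ => Algebra.IsIntegral.isIntegral x
  have hfinE : FiniteDimensional K ↥(adjoin K (g '' (T : Set Ω))) := by
    have : Finite (g '' (T : Set Ω)) := (T.finite_toSet.image g).to_subtype
    exact finiteDimensional_adjoin fun x _ => Algebra.IsIntegral.isIntegral x
  have hLpos : 0 < Module.finrank K L := Module.finrank_pos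
  have hle : Module.finrank K (preimField K Ω F β (N + 1)) ≤
      Module.finrank K ↥(L ⊔ adjoin K (g '' (T : Set Ω))) :=
    LinearMap.finrank_le_finrank_of_injective (f := (inclusion hgen).toLinearMap)
      (inclusion hgen).injective
  refine hle.trans_lt ?_
  by_cases hc : T.card < d ^ N
  · have := multi_le d hd0 L (T.image g) (by
      intro x hx
      obtain ⟨a, ha, rfl⟩ := Finset.mem_image.1 hx
      exact hgL a ha)
    rw [Finset.coe_image] at this
    refine this.trans_lt (Nat.mul_lt_mul_of_pos_right ?_ hLpos)
    exact Nat.pow_lt_pow_right hd (Finset.card_image_le.trans_lt hc)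
  · have hTc : T.card = d ^ N :=
      le_antisymm (hcard ▸ Multiset.toFinset_card_le R) (not_lt.1 hc)
    have hnd : R.Nodup := Multiset.toFinset_card_eq_card_iff_nodup.1 (hTc.trans hcard.symm)
    set δ : Ω := ((shiftIter Ω F β M).roots.map g).prod with hδdef
    have hδ : δ ∈ L := by
      refine multiset_prod_mem _ fun y hy => ?_
      obtain ⟨a, ha, rfl⟩ := Multiset.mem_map.1 hy
      have ha' := (mem_shiftIter_roots Ω d hd0 c β M a).1 ha
      refine L.mul_mem (L.algebraMap_mem ε) ?_
      refine preim_mono d hd0 c β (Nat.succ_le_of_lt hMN) (preim_mem _ _ _ _ ?_)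
      refine (preim_up d c β M (γ a)).2 ?_
      rw [hγ]; simpa using ha'
    have hprod : (∏ a ∈ T, g a) ^ d = δ ^ d := by
      have e1 : (∏ a ∈ T, g a) = (R.map g).prod := by
        rw [Finset.prod, hT, Multiset.toFinset_val, Multiset.dedup_eq_self.2 hnd]
      rw [e1, hδdef, ← Multiset.prod_map_pow, ← Multiset.prod_map_pow]
      simp only [hgd]
      rw [hR, shiftIter_prod Ω d hd0, shiftIter_prod Ω d hd0, h]
    refine (dep_le d hd0 ζ hζ L T hTpos g hgL δ hδ hprod).trans_lt
      (Nat.mul_lt_mul_of_pos_right (Nat.pow_lt_pow_right hd ?_) hLpos)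
    rw [hTc]
    exact Nat.sub_lt (pow_pos hd0 N) one_pos

/-- if `f = X^d + c` is postcritically finite, then for infinitely many `n`
the degree `[K_n(β) : K_{n-1}(β)]` is strictly smaller than `d^(d^(n-1))` (infinite index of
the arboreal image in the iterated wreath product, in degree form). -/
theorem stmt_16 (d : ℕ) (hd : 2 ≤ d)
    (K : Type*) [Field K] [Algebra (RatFunc (AlgebraicClosure ℚ)) K]
    [FunctionField (AlgebraicClosure ℚ) K]
    (Ω : Type*) [Field Ω] [Algebra K Ω] [IsAlgClosure K Ω]
    (c : K) (f : K[X]) (hf : f = X ^ d + C c)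
    (hpcf : ∃ n m : ℕ, m < n ∧ (polyIter f n).eval 0 = (polyIter f m).eval 0)
    (β : K) :
    {n : ℕ | 1 ≤ n ∧
      Module.finrank K (preimField K Ω f β n) <
        d ^ (d ^ (n - 1)) * Module.finrank K (preimField K Ω f β (n - 1))}.Infinite := by
  subst hf
  obtain ⟨n, m, hmn, h⟩ := hpcf
  have hd0 : 0 < d := by omega
  have : NeZero d := ⟨hd0.ne'⟩
  let φ : AlgebraicClosure ℚ →+* K :=
    (algebraMap (RatFunc (AlgebraicClosure ℚ)) K).comp RatFunc.C
  obtain ⟨ζ, hζ⟩ := HasEnoughRootsOfUnity.exists_primitiveRoot (AlgebraicClosure ℚ) d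
  obtain ⟨ε, hε⟩ := IsAlgClosed.exists_pow_nat_eq (-1 : AlgebraicClosure ℚ) hd0
  refine Set.infinite_of_forall_exists_gt fun k => ⟨n + k + 1, ⟨by omega, ?_⟩, by omega⟩
  exact main_step d hd (φ ζ) (hζ.map_of_injective φ.injective) (φ ε)
    (by rw [← map_pow, hε, map_neg, map_one]) c β (n + k) (m + k) (by omega)
    (polyIter_add_eval _ 0 n m (k + 1) h)
end
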